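/- Let U and V be irreducible words such that the word UV is freely reduced. If UV contains no (4g−1)-LLFR, then |U| + |V| − |w| ≤ 4g, where w ∈ G is the group element represented by UV and |w| is its word length. -/

import Mathlib

namespace SG

/-- A letter of the alphabet `S± = {cᵢ^{±1}}`: `(i, true)` is `c_{i+1}`,
`(i, false)` is `c_{i+1}⁻¹`. -/
abbrev Letter (g : ℕ) := Fin (2*g) × Bool

/-- A word in the alphabet `S±`. -/
abbrev Word (g : ℕ) := List (Letter g)

/-- The surface relator `c₁c₂⋯c_{2g}c₁⁻¹c₂⁻¹⋯c_{2g}⁻¹` in the free group. -/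
def relator (g : ℕ) : FreeGroup (Fin (2*g)) :=
  (List.ofFn fun i : Fin (2*g) => FreeGroup.of i).prod *
  (List.ofFn fun i : Fin (2*g) => (FreeGroup.of i)⁻¹).prod

/-- The surface group with the symmetric presentation. -/
abbrev SurfaceGroup (g : ℕ) :=
  PresentedGroup ({relator g} : Set (FreeGroup (Fin (2*g))))

/-- The generator `c_{i+1}` of the surface group. -/
def gen (g : ℕ) (i : Fin (2*g)) : SurfaceGroup g := PresentedGroup.of i

/-- The inverse of a letter. -/
def invLetter (g : ℕ) (a : Letter g) : Letter g := (a.1, !a.2)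

/-- The group element represented by a letter. -/
def evalLetter (g : ℕ) (a : Letter g) : SurfaceGroup g :=
  if a.2 then gen g a.1 else (gen g a.1)⁻¹

/-- The group element represented by a word. -/
def eval (g : ℕ) (W : Word g) : SurfaceGroup g := (W.map (evalLetter g)).prod

/-- The formal inverse `x_n⁻¹ ⋯ x₁⁻¹` of a word `x₁ ⋯ x_n`. -/
def wordInv (g : ℕ) (W : Word g) : Word g := (W.map (invLetter g)).reverse

/-- Word length of a group element: the least `n` such that the element is a
product of `n` elements of `S ∪ S⁻¹`. -/
noncomputable def len (g : ℕ) (u : SurfaceGroup g) : ℕ :=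
  sInf {n | ∃ W : Word g, W.length = n ∧ eval g W = u}

/-- `conjLen g u v` is the minimum of `|x|` over conjugators `x` with `x⁻¹ux = v`. -/
noncomputable def conjLen (g : ℕ) (u v : SurfaceGroup g) : ℕ :=
  sInf {k | ∃ x : SurfaceGroup g, x⁻¹ * u * x = v ∧ len g x = k}

/-- The conjugator length function: `CL g n` is the least `N` such that any
conjugate `u, v` with `|u| + |v| ≤ n` admit a conjugator of length `≤ N`. -/
noncomputable def CL (g : ℕ) (n : ℕ) : ℕ :=
  sInf {N | ∀ u v : SurfaceGroup g,
    (∃ x : SurfaceGroup g, x⁻¹ * u * x = v) → len g u + len g v ≤ n →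
      conjLen g u v ≤ N}

/-- Rank of a letter in the ascending order
`c_{2g} ≺ ⋯ ≺ c₂ ≺ c₁ ≺ c₁⁻¹ ≺ c₂⁻¹ ≺ ⋯ ≺ c_{2g}⁻¹`. -/
def rank (g : ℕ) (a : Letter g) : ℕ :=
  if a.2 then (2*g - 1) - (a.1 : ℕ) else 2*g + (a.1 : ℕ)

/-- The strict order `≺` on letters. -/
def letterLt (g : ℕ) (a b : Letter g) : Prop := rank g a < rank g b

/-- The length-lexicographical order `≺` on words. -/
def wordLt (g : ℕ) (X Y : Word g) : Prop :=
  X.length < Y.length ∨ (X.length = Y.length ∧ List.Lex (letterLt g) X Y)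

/-- A word is irreducible if it is the `≺`-least word representing its element. -/
def IrreducibleWord (g : ℕ) (W : Word g) : Prop :=
  ∀ W' : Word g, eval g W' = eval g W → W' = W ∨ wordLt g W W'

/-- A word is cyclically irreducible if all its cyclic permutations are irreducible. -/
def CyclicallyIrreducibleWord (g : ℕ) (W : Word g) : Prop :=
  ∀ W' : Word g, List.IsRotated W W' → IrreducibleWord g W'

/-- A word is freely reduced if no letter is followed by its inverse. -/
def FreelyReduced (g : ℕ) (W : Word g) : Prop :=
  List.Chain' (fun a c => c ≠ invLetter g a) W

/-- The normal form of a group element: the `≺`-least word representing it. -/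
noncomputable def nf (g : ℕ) (x : SurfaceGroup g) : Word g := by
  classical
  exact if h : ∃ W : Word g, eval g W = x ∧ IrreducibleWord g W then h.choose else []

/-- The word `R = c₁c₂⋯c_{2g}c₁⁻¹c₂⁻¹⋯c_{2g}⁻¹`. -/
def Rword (g : ℕ) : Word g :=
  (List.ofFn fun i : Fin (2*g) => ((i, true) : Letter g)) ++
  (List.ofFn fun i : Fin (2*g) => ((i, false) : Letter g))

/-- `𝓡`: all cyclic permutations of `R` and of `R⁻¹`. -/
def RSet (g : ℕ) : Set (Word g) :=
  {W | List.IsRotated (Rword g) W ∨ List.IsRotated (wordInv g (Rword g)) W}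

/-- `seg g b i k` is the word `b_i b_{i+1} ⋯ b_{i+k-1}`. -/
def seg (g : ℕ) (b : ℕ → Letter g) (i k : ℕ) : Word g :=
  (List.range k).map fun j => b (i + j)

/-- `dseg g b i k` is the descending word `b_i b_{i-1} ⋯ b_{i-k+1}`
(indices taken modulo `4g`, using periodicity of `b`). -/
def dseg (g : ℕ) (b : ℕ → Letter g) (i k : ℕ) : Word g :=
  (List.range k).map fun j => b (i + 4*g - j)

/-- `b : ℕ → Letter g` is a `4g`-periodic (1-based) enumeration of the letters
`b₁, …, b_{4g}` of some word `b₁⋯b_{4g} ∈ 𝓡`. -/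
def RelSeq (g : ℕ) (b : ℕ → Letter g) : Prop :=
  (∀ i, b (i + 4*g) = b i) ∧ seg g b 1 (4*g) ∈ RSet g

/-- The `t`-th power `W^t` of a word. -/
def wpow (g : ℕ) (W : Word g) (t : ℕ) : Word g := (List.replicate t W).flatten

/-- A `k`-fractional relator: an initial segment of length `k` (with `2 ≤ k ≤ 4g`)
of some word in `𝓡`. -/
def IsFR (g : ℕ) (k : ℕ) (W : Word g) : Prop :=
  2 ≤ k ∧ k ≤ 4*g ∧ ∃ B ∈ RSet g, W = B.take k

/-- `IsLLFROcc g k W P F Q` : the factorization `W = P ++ F ++ Q` exhibits `F`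
as a `k`-locally longest fractional relator of `W`. -/
def IsLLFROcc (g : ℕ) (k : ℕ) (W P F Q : Word g) : Prop :=
  W = P ++ F ++ Q ∧ IsFR g k F ∧
  (∀ a, P.getLast? = some a → ¬ IsFR g (k+1) (a :: F)) ∧
  (∀ a, Q.head? = some a → ¬ IsFR g (k+1) (F ++ [a]))

/-- `W` contains a `k`-LLFR. -/
def HasLLFR (g : ℕ) (k : ℕ) (W : Word g) : Prop :=
  ∃ P F Q, IsLLFROcc g k W P F Q

/-- Length-lexicographical order on pairs of words. -/
def pairLt (g : ℕ) (p q : Word g × Word g) : Prop :=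
  wordLt g p.1 q.1 ∨ (p.1 = q.1 ∧ wordLt g p.2 q.2)

/-- A candidate for the reducing-subword pair of `(W₁, W₂)`. -/
def IsRSCand (g : ℕ) (W₁ W₂ C₁ C₂ : Word g) : Prop :=
  ∃ A B C' : Word g, W₁ = A ++ C₁ ∧ W₂ = C₂ ++ B ∧
    nf g (eval g (W₁ ++ W₂)) = A ++ C' ++ B

/-- `(C₁, C₂)` is the reducing-subword pair `rs(W₁, W₂)`: the `≺`-least candidate. -/
def IsRS (g : ℕ) (W₁ W₂ C₁ C₂ : Word g) : Prop :=
  IsRSCand g W₁ W₂ C₁ C₂ ∧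
  ∀ D₁ D₂ : Word g, IsRSCand g W₁ W₂ D₁ D₂ →
    (C₁ = D₁ ∧ C₂ = D₂) ∨ pairLt g (C₁, C₂) (D₁, D₂)

end SG

namespace SG

open CoxeterSystem

section Coxeter

variable {B W : Type*} [Group W] {M : CoxeterMatrix B} (cs : CoxeterSystem M W)

open Classical in
/-- The action of a simple reflection on `W × ℤ/2`. -/
noncomputable def reflStep (i : B) : Equiv.Perm (W × ZMod 2) where
  toFun p := (cs.simple i * p.1 * cs.simple i, p.2 + if p.1 = cs.simple i then 1 else 0)
  invFun p := (cs.simple i * p.1 * cs.simple i, p.2 + if p.1 = cs.simple i then 1 else 0)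
  left_inv := by
    rintro ⟨t, e⟩
    have h : (cs.simple i * t * cs.simple i = cs.simple i) ↔ t = cs.simple i := by
      constructor
      · intro h
        have := congrArg (fun z => cs.simple i * z * cs.simple i) h
        simpa [mul_assoc] using this
      · rintro rfl; simp
    have h2 : ∀ x : ZMod 2, x + x = 0 := by decide
    by_cases ht : t = cs.simple i
    · subst ht; simp [add_assoc, h2]
    · simp [mul_assoc, ht]
      simpa [mul_assoc, ht] using h
  right_inv := by
    rintro ⟨t, e⟩
    have h : (cs.simple i * t * cs.simple i = cs.simple i) ↔ t = cs.simple i := by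
      constructor
      · intro h
        have := congrArg (fun z => cs.simple i * z * cs.simple i) h
        simpa [mul_assoc] using this
      · rintro rfl; simp
    have h2 : ∀ x : ZMod 2, x + x = 0 := by decide
    by_cases ht : t = cs.simple i
    · subst ht; simp [add_assoc, h2]
    · simp [mul_assoc, ht]
      simpa [mul_assoc, ht] using h

open Classical in
theorem reflStep_apply (i : B) (t : W) (e : ZMod 2) :
    reflStep cs i (t, e) =
      (cs.simple i * t * cs.simple i, e + if t = cs.simple i then 1 else 0) := rfl

theorem dihedral_shift (i j : B) (n : ℕ) :
    (cs.simple i * cs.simple j) ^ n * cs.simple j * (cs.simple i * cs.simple j) ^ n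
      = cs.simple j := by
  induction n with
  | zero => simp
  | succ n ih =>
    calc _ = (cs.simple i * cs.simple j) * ((cs.simple i * cs.simple j) ^ n * cs.simple j *
          (cs.simple i * cs.simple j) ^ n) * (cs.simple i * cs.simple j) := by
          rw [pow_succ']
          nth_rewrite 2 [← pow_succ']
          rw [pow_succ]; simp only [mul_assoc]
      _ = _ := by rw [ih]; simp [mul_assoc]

open Classical in
theorem reflStep_pow (i j : B) (n : ℕ) (t : W) (e : ZMod 2) :
    ((reflStep cs i * reflStep cs j) ^ n) (t, e) =
      ((cs.simple i * cs.simple j) ^ n * t * ((cs.simple i * cs.simple j) ^ n)⁻¹,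
        e + ∑ l ∈ Finset.range (2 * n),
          if t = cs.simple j * (cs.simple i * cs.simple j) ^ l then 1 else 0) := by
  induction n with
  | zero => simp
  | succ n ih =>
    rw [pow_succ', Equiv.Perm.mul_apply, ih, Equiv.Perm.mul_apply, reflStep_apply, reflStep_apply]
    set r := cs.simple i * cs.simple j with hr
    have hrinv : r⁻¹ = cs.simple j * cs.simple i := by simp [hr]
    have hs := dihedral_shift cs i j n
    rw [← hr] at hs
    have e1 : (r ^ n * t * (r ^ n)⁻¹ = cs.simple j) ↔ t = cs.simple j * r ^ (2 * n) := by
      constructor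
      · intro h
        have : r ^ n * t = cs.simple j * r ^ n := by rw [← h]; group
        have h3 : r ^ n * t = r ^ n * (cs.simple j * r ^ (2 * n)) := by
          rw [this, two_mul, pow_add]
          conv_lhs => rw [← hs]
          simp [mul_assoc]
        exact mul_left_cancel h3
      · rintro rfl
        rw [two_mul, pow_add]
        conv_rhs => rw [← hs]
        group
    have e2 : (cs.simple j * (r ^ n * t * (r ^ n)⁻¹) * cs.simple j = cs.simple i) ↔
        t = cs.simple j * r ^ (2 * n + 1) := by
      have : (cs.simple j * (r ^ n * t * (r ^ n)⁻¹) * cs.simple j = cs.simple i) ↔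
          (r ^ n * (t * r⁻¹) * (r ^ n)⁻¹ = cs.simple j) := by
        have h4 : r ^ n * (t * r⁻¹) * (r ^ n)⁻¹ = r ^ n * t * (r ^ n)⁻¹ * r⁻¹ := by group
        rw [h4, hrinv]
        constructor
        · intro h
          have := congrArg (fun z => cs.simple j * z) h
          simp only [mul_assoc, simple_mul_simple_cancel_left] at this
          have := congrArg (fun z => z * cs.simple i) this
          simpa [mul_assoc] using this
        · intro h
          have := congrArg (fun z => cs.simple j * z * cs.simple i) h
          simpa [mul_assoc] using this
      rw [this]
      constructor
      · intro h
        have h5 : r ^ n * (t * r⁻¹) = cs.simple j * r ^ n := by rw [← h]; group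
        have h3 : r ^ n * (t * r⁻¹) = r ^ n * (cs.simple j * r ^ (2 * n)) := by
          rw [h5, two_mul, pow_add]
          conv_lhs => rw [← hs]
          simp [mul_assoc]
        have h6 := mul_left_cancel h3
        rw [pow_succ, ← mul_assoc, ← h6]; group
      · rintro rfl
        rw [pow_succ, two_mul, pow_add]
        conv_rhs => rw [← hs]
        group
    rw [show 2 * (n + 1) = 2 * n + 1 + 1 by ring, Finset.sum_range_succ, Finset.sum_range_succ]
    simp only [e1, e2]
    ext1
    · simp only [pow_succ', mul_inv_rev, hrinv]
      simp only [hr, mul_assoc]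
    · simp only [add_assoc]

theorem reflStep_liftable : M.IsLiftable (reflStep cs) := by
  classical
  intro i j
  ext1 ⟨t, e⟩
  rw [reflStep_pow, simple_mul_simple_pow, two_mul, Finset.sum_range_add]
  have h2 : ∀ x : ZMod 2, x + x = 0 := by decide
  simp [pow_add, h2]

noncomputable def reflHom : W →* Equiv.Perm (W × ZMod 2) :=
  cs.lift ⟨reflStep cs, reflStep_liftable cs⟩

open Classical in
theorem reflHom_wordProd (ω : List B) (t : W) (e : ZMod 2) :
    reflHom cs (cs.wordProd ω) (t, e) =
      (cs.wordProd ω * t * (cs.wordProd ω)⁻¹, e + ((cs.rightInvSeq ω).count t : ℕ)) := by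
  induction ω with
  | nil => simp
  | cons i ω ih =>
    rw [wordProd_cons, map_mul, Equiv.Perm.mul_apply, ih]
    have : reflHom cs (cs.simple i) = reflStep cs i := by
      simp [reflHom]
    rw [this, reflStep_apply]
    simp only [rightInvSeq, List.count_cons]
    ext1
    · simp [mul_assoc]
    · have : (cs.wordProd ω * t * (cs.wordProd ω)⁻¹ = cs.simple i) ↔
          ((cs.wordProd ω)⁻¹ * cs.simple i * cs.wordProd ω = t) := by
        constructor
        · intro h; rw [← h]; group
        · rintro rfl; group
      simp [this, add_assoc]

open Classical in
theorem count_rightInvSeq (ω ω' : List B) (h : cs.wordProd ω = cs.wordProd ω') (t : W) :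
    (((cs.rightInvSeq ω).count t : ℕ) : ZMod 2) = ((cs.rightInvSeq ω').count t : ℕ) := by
  have h1 := reflHom_wordProd cs ω t 0
  have h2 := reflHom_wordProd cs ω' t 0
  rw [h, h2] at h1
  simpa using (congrArg Prod.snd h1).symm

theorem mem_rightInvSeq_of_descent (ω : List B) (i : B)
    (h : cs.IsRightDescent (cs.wordProd ω) i) : cs.simple i ∈ cs.rightInvSeq ω := by
  classical
  obtain ⟨ω1, hr, hω1⟩ := cs.exists_isReduced (cs.wordProd ω * cs.simple i)
  have e1 : cs.wordProd (ω1.concat i) = cs.wordProd ω := by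
    rw [wordProd_concat, ← hω1]; simp
  have hc := count_rightInvSeq cs _ _ e1 (cs.simple i)
  rw [rightInvSeq_concat] at hc
  have hn : cs.simple i ∉ cs.rightInvSeq ω1 := by
    intro hm
    have := (isRightInversion_of_mem_rightInvSeq cs hr hm).2
    rw [← hω1] at this
    simp at this
    have h' : cs.length (cs.wordProd ω * cs.simple i) < cs.length (cs.wordProd ω) := h
    omega
  by_contra hm
  rw [List.count_eq_zero_of_not_mem hm, List.concat_eq_append, List.count_append] at hc
  rw [List.count_eq_zero_of_not_mem] at hc
  · simp at hc
  · intro hx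
    rw [List.mem_map] at hx
    obtain ⟨t, ht, hx⟩ := hx
    apply hn
    have : t = cs.simple i := by
      have := congrArg (fun z => cs.simple i * z * cs.simple i) hx
      simpa [mul_assoc] using this
    rwa [← this]

theorem mem_leftInvSeq_of_descent (ω : List B) (i : B)
    (h : cs.IsLeftDescent (cs.wordProd ω) i) : cs.simple i ∈ cs.leftInvSeq ω := by
  have h1 : cs.IsRightDescent (cs.wordProd ω.reverse) i := by
    rw [wordProd_reverse, isRightDescent_inv_iff]; exact h
  have := mem_rightInvSeq_of_descent cs _ _ h1
  rw [rightInvSeq_reverse] at this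
  simpa using this

/-- alternating word of length `m` starting with `i`. -/
def alt (i j : B) : ℕ → List B
  | 0 => []
  | m + 1 => i :: alt j i m

theorem length_alt (i j : B) (m : ℕ) : (alt i j m).length = m := by
  induction m generalizing i j with
  | zero => rfl
  | succ m ih => simp [alt, ih]

theorem alt_add (i j : B) (m n : ℕ) : ∃ a b, alt i j (m + n) = alt i j m ++ alt a b n := by
  induction m generalizing i j with
  | zero => exact ⟨i, j, by simp [alt]⟩
  | succ m ih =>
    obtain ⟨a, b, h⟩ := ih j i
    exact ⟨a, b, by rw [show m + 1 + n = (m + n) + 1 by ring]; simp [alt, h]⟩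

theorem wordProd_alt_even (i j : B) (m : ℕ) :
    cs.wordProd (alt i j (2 * m)) = (cs.simple i * cs.simple j) ^ m := by
  induction m with
  | zero => simp [alt]
  | succ m ih =>
    rw [show 2 * (m + 1) = 2 * m + 1 + 1 by ring, pow_succ']
    simp only [alt, wordProd_cons, ih, mul_assoc]

theorem mem_leftInvSeq_alt (i j : B) (m : ℕ) (t : W) (h : t ∈ cs.leftInvSeq (alt i j m)) :
    ∃ k, k < m ∧ t = (cs.simple i * cs.simple j) ^ k * cs.simple i := by
  induction m generalizing i j t with
  | zero => simp [alt] at h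
  | succ m ih =>
    simp only [alt, leftInvSeq, List.mem_cons, List.mem_map] at h
    rcases h with rfl | ⟨u, hu, rfl⟩
    · exact ⟨0, by omega, by simp⟩
    · obtain ⟨k, hk, rfl⟩ := ih j i u hu
      refine ⟨k + 1, by omega, ?_⟩
      simp only [MulAut.conj_apply, inv_simple]
      have : ∀ n : ℕ, cs.simple i * (cs.simple j * cs.simple i) ^ n =
          (cs.simple i * cs.simple j) ^ n * cs.simple i := by
        intro n
        induction n with
        | zero => simp
        | succ n ih => rw [pow_succ, ← mul_assoc, ih, pow_succ]; simp [mul_assoc]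
      rw [← mul_assoc, this, pow_succ]
      simp [mul_assoc]

/-- order of product of two simple reflections in an even Coxeter group -/
theorem order_even (he : ∀ i j, i ≠ j → Even (M i j)) (i j : B) (hij : i ≠ j) (k : ℕ)
    (hk : (cs.simple i * cs.simple j) ^ k = 1) : M i j ∣ k := by
  classical
  let f : B → DihedralGroup (M i j) := fun b =>
    if b = i then DihedralGroup.sr 0 else if b = j then DihedralGroup.sr 1 else 1
  have hsq : ∀ b, f b * f b = 1 := by
    intro b
    simp only [f]
    split_ifs <;> simp
  have hlift : M.IsLiftable f := by
    intro a b
    by_cases hab : a = b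
    · subst hab; simp [hsq]
    have hev := he a b hab
    obtain ⟨n, hn⟩ := hev
    by_cases h1 : a = i ∧ b = j
    · obtain ⟨rfl, rfl⟩ := h1
      simp [f, Ne.symm hij]
    by_cases h2 : a = j ∧ b = i
    · obtain ⟨rfl, rfl⟩ := h2
      have : f a * f b = (DihedralGroup.r 1)⁻¹ := by simp [f, Ne.symm hij]
      rw [this, inv_pow, M.symmetric, DihedralGroup.r_one_pow]
      simp
    have h3 : f a = 1 ∨ f b = 1 := by
      simp only [f]
      by_contra hcon
      push Not at hcon
      obtain ⟨c1, c2⟩ := hcon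
      have : a = i ∨ a = j := by
        by_contra h; push Not at h; simp [h.1, h.2] at c1
      have : b = i ∨ b = j := by
        by_contra h; push Not at h; simp [h.1, h.2] at c2
      grind
    rcases h3 with h3 | h3
    · rw [h3, one_mul, hn, ← two_mul, pow_mul, pow_two, hsq, one_pow]
    · rw [h3, mul_one, hn, ← two_mul, pow_mul, pow_two, hsq, one_pow]
  have h := congrArg (cs.lift ⟨f, hlift⟩) hk
  rw [map_pow, map_mul, lift_apply_simple, lift_apply_simple, map_one] at h
  simp [f, Ne.symm hij] at h
  rw [DihedralGroup.one_def] at h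
  injection h with h
  exact (ZMod.natCast_eq_zero_iff _ _).1 (by simpa using h)

/-- `w` has the alternating word as a length-additive prefix. -/
def AltPre (w : W) (i j : B) (m : ℕ) : Prop :=
  ∃ w', w = cs.wordProd (alt i j m) * w' ∧ cs.length w = m + cs.length w'

theorem AltPre.mono {w : W} {i j : B} {m n : ℕ} (h : AltPre cs w i j n) (hm : m ≤ n) :
    AltPre cs w i j m := by
  obtain ⟨w', h1, h2⟩ := h
  obtain ⟨k, rfl⟩ := Nat.exists_eq_add_of_le hm
  obtain ⟨a, b, hab⟩ := alt_add i j m k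
  refine ⟨cs.wordProd (alt a b k) * w', ?_, ?_⟩
  · rw [h1, hab, wordProd_append, mul_assoc]
  · have u1 := cs.length_mul_le (cs.wordProd (alt a b k)) w'
    have u2 := cs.length_wordProd_le (alt a b k)
    rw [length_alt] at u2
    have u3 := cs.length_mul_le (cs.wordProd (alt i j m)) (cs.wordProd (alt a b k) * w')
    rw [← mul_assoc, ← wordProd_append, ← hab, ← h1] at u3
    have u4 := cs.length_wordProd_le (alt i j m)
    rw [length_alt] at u4
    rw [hab, wordProd_append, mul_assoc] at h1
    omega

theorem altPre_step (he : ∀ i j, i ≠ j → Even (M i j)) {w : W} {i j : B} (hij : i ≠ j)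
    (hj : cs.IsLeftDescent w j) {m : ℕ} (h : AltPre cs w i j m) :
    AltPre cs w j i (m + 1) ∨ (M i j ≠ 0 ∧ AltPre cs w i j (M i j)) := by
  obtain ⟨w', h1, h2⟩ := h
  obtain ⟨β, hβ, rfl⟩ := cs.exists_isReduced w'
  rw [← wordProd_append] at h1
  have hd : cs.IsLeftDescent (cs.wordProd (alt i j m ++ β)) j := by rwa [← h1]
  have hmem := mem_leftInvSeq_of_descent cs _ _ hd
  obtain ⟨k, hk, hkk⟩ := List.mem_iff_getElem.1 hmem
  have hk' : k < (alt i j m ++ β).length := by simpa using hk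
  by_cases hkm : k < m
  · right
    have h3 : cs.simple j ∈ cs.leftInvSeq (alt i j m) := by
      have := cs.leftInvSeq_take (alt i j m ++ β) m
      rw [List.take_left' (length_alt i j m)] at this
      rw [this, ← hkk]
      rw [List.mem_take_iff_getElem]
      exact ⟨k, lt_min_iff.2 ⟨hkm, hk⟩, rfl⟩
    obtain ⟨q, hq, hqq⟩ := mem_leftInvSeq_alt cs i j m _ h3
    have h4 : (cs.simple i * cs.simple j) ^ (q + 1) = 1 := by
      rw [pow_succ, ← mul_assoc, ← hqq]; simp
    have h5 := order_even cs he i j hij _ h4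
    have h6 := Nat.le_of_dvd (by omega) h5
    refine ⟨?_, AltPre.mono cs ⟨_, by rw [h1, wordProd_append], h2⟩ (by omega : M i j ≤ m)⟩
    rintro h0
    rw [h0] at h5
    simp at h5
  · left
    have h3 := cs.getD_leftInvSeq_mul_wordProd (alt i j m ++ β) k
    rw [List.getD_eq_getElem _ _ hk, hkk, List.eraseIdx_append_of_length_le (by rw [length_alt]; omega),
      length_alt, ← h1] at h3
    refine ⟨cs.wordProd (β.eraseIdx (k - m)), ?_, ?_⟩
    · simp only [alt, wordProd_cons, mul_assoc]
      rw [← wordProd_append, ← h3]; simp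
    · have u2 := cs.length_wordProd_le (β.eraseIdx (k - m))
      have hl : k - m < β.length := by simp [length_alt] at hk'; omega
      rw [List.length_eraseIdx_of_lt hl] at u2
      have u3 := hβ.eq
      have u4 := cs.length_mul_le (cs.wordProd (alt i j m)) (cs.wordProd (β.eraseIdx (k - m)))
      rw [← wordProd_append, ← h3] at u4
      have u5 := cs.length_wordProd_le (alt i j m)
      rw [length_alt] at u5
      have u6 := (cs.isLeftDescent_iff).1 hj
      omega

theorem two_descents (he : ∀ i j, i ≠ j → Even (M i j)) {w : W} {i j : B} (hij : i ≠ j)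
    (hi : cs.IsLeftDescent w i) (hj : cs.IsLeftDescent w j) :
    M i j ≠ 0 ∧ AltPre cs w i j (M i j) := by
  by_contra hcon
  have hswap : ¬ (M j i ≠ 0 ∧ AltPre cs w j i (M j i)) := by
    rintro ⟨a1, a2⟩
    rw [M.symmetric] at a1
    refine hcon ⟨a1, ?_⟩
    obtain ⟨w', b1, b2⟩ := a2
    rw [M.symmetric] at b1 b2
    refine ⟨w', ?_, b2⟩
    rw [b1]
    congr 1
    obtain ⟨n, hn⟩ := he i j hij
    rw [hn, ← two_mul, wordProd_alt_even, wordProd_alt_even]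
    have h1 := cs.simple_mul_simple_pow i j
    rw [hn, pow_add] at h1
    rw [← inv_eq_of_mul_eq_one_right h1, ← inv_pow]
    simp
  have key : ∀ m, AltPre cs w i j m ∧ AltPre cs w j i m := by
    intro m
    induction m with
    | zero => exact ⟨⟨w, by simp [alt], by simp⟩, ⟨w, by simp [alt], by simp⟩⟩
    | succ m ih =>
      constructor
      · rcases altPre_step cs he (Ne.symm hij) hi ih.2 with h | h
        · exact h
        · exact absurd h hswap
      · rcases altPre_step cs he hij hj ih.1 with h | h
        · exact h
        · exact absurd h hcon
  obtain ⟨w', _, h2⟩ := (key (cs.length w + 1)).1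
  omega

end Coxeter

end SG
namespace SG

section Abstract

variable {g : ℕ} {G : Type*} [Group G]

/-- `k` is (the index of) a first letter of a geodesic for `y`. -/
def Dsc (e : ZMod (4*g) → G) (ln : G → ℕ) (y : G) (k : ZMod (4*g)) : Prop :=
  ln ((e k)⁻¹ * y) + 1 = ln y

/-- Strip off the letters `k, k+d, …` (`m` of them) from `y`. -/
def Quo (e : ZMod (4*g) → G) : G → ZMod (4*g) → ZMod (4*g) → ℕ → G
  | y, _, _, 0 => y
  | y, k, d, m + 1 => Quo e ((e k)⁻¹ * y) (k + d) d m

/-- `y` has a geodesic starting with `k, k+d, …` (`m` letters). -/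
def Pre (e : ZMod (4*g) → G) (ln : G → ℕ) : G → ZMod (4*g) → ZMod (4*g) → ℕ → Prop
  | _, _, _, 0 => True
  | y, k, d, m + 1 => Dsc e ln y k ∧ Pre e ln ((e k)⁻¹ * y) (k + d) d m

/-- The properties of the surface group used in the combinatorial argument. -/
structure GSys (g : ℕ) (G : Type*) [Group G] where
  e : ZMod (4*g) → G
  ln : G → ℕ
  T : ZMod (4*g)
  hg : 2 ≤ g
  T_def : T = ((2*g : ℕ) : ZMod (4*g))
  e_inv : ∀ k, e (k + T) = (e k)⁻¹
  ln_one : ln 1 = 0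
  ln_inv : ∀ y, ln y⁻¹ = ln y
  step : ∀ k y, ln (e k * y) = ln y + 1 ∨ ln (e k * y) + 1 = ln y
  exists_desc : ∀ y, y ≠ 1 → ∃ k, Dsc e ln y k
  swap : ∀ y k d, (d = 1 ∨ d = -1) →
    Quo e y k d (2*g) = Quo e y (k + T - d) (-d) (2*g)
  two' : ∀ y k k', k ≠ k' → Dsc e ln y k → Dsc e ln y k' →
    ∃ d, (d = 1 ∨ d = -1) ∧ k' = k + T - d ∧ ln (Quo e y k d (2*g)) + 2*g = ln y

namespace GSys

variable (S : GSys g G)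

def D (y : G) (k : ZMod (4*g)) : Prop := Dsc S.e S.ln y k
def Q (y : G) (k d : ZMod (4*g)) (m : ℕ) : G := Quo S.e y k d m
def P (y : G) (k d : ZMod (4*g)) (m : ℕ) : Prop := Pre S.e S.ln y k d m

theorem TT : S.T + S.T = 0 := by
  rw [S.T_def, ← Nat.cast_add, show 2*g + 2*g = 4*g by ring]
  exact ZMod.natCast_self _

theorem nz (c : ℕ) (h : ¬ (4*g ∣ c)) : (c : ZMod (4*g)) ≠ 0 := by
  intro h1
  exact h ((ZMod.natCast_eq_zero_iff _ _).1 h1)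

theorem n2 (S : GSys g G) : (2 : ZMod (4*g)) ≠ 0 := by
  have := nz (g := g) 2 (fun h => by have := Nat.le_of_dvd (by norm_num) h; have := S.hg; omega)
  exact_mod_cast this
theorem n4 (S : GSys g G) : (4 : ZMod (4*g)) ≠ 0 := by
  have := nz (g := g) 4 (fun h => by have := Nat.le_of_dvd (by norm_num) h; have := S.hg; omega)
  exact_mod_cast this
theorem n6 (S : GSys g G) : (6 : ZMod (4*g)) ≠ 0 := by
  have := nz (g := g) 6 (fun h => by have := Nat.le_of_dvd (by norm_num) h; have := S.hg; omega)
  exact_mod_cast this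
theorem n10 (S : GSys g G) : (10 : ZMod (4*g)) ≠ 0 := by
  have := nz (g := g) 10 (fun h => by
    have := S.hg
    obtain ⟨c, hc⟩ := h
    have : 2 * (g * c) = 5 := by linarith
    omega)
  exact_mod_cast this

@[simp] theorem P_zero (y : G) (k d) : S.P y k d 0 := trivial
theorem P_succ (y : G) (k d) (m : ℕ) :
    S.P y k d (m+1) ↔ S.D y k ∧ S.P ((S.e k)⁻¹ * y) (k+d) d m := Iff.rfl
@[simp] theorem Q_zero (y : G) (k d) : S.Q y k d 0 = y := rfl
theorem Q_succ (y : G) (k d) (m : ℕ) :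
    S.Q y k d (m+1) = S.Q ((S.e k)⁻¹ * y) (k+d) d m := rfl
theorem P_one (y : G) (k d) : S.P y k d 1 ↔ S.D y k := by simp [P_succ]

theorem Q_add (y : G) (k d) (m n : ℕ) :
    S.Q y k d (m+n) = S.Q (S.Q y k d m) (k + m*d) d n := by
  induction m generalizing y k with
  | zero => simp
  | succ m ih =>
    rw [show m + 1 + n = (m + n) + 1 by ring, Q_succ, Q_succ, ih]
    congr 1
    push_cast; ring

theorem P_add (y : G) (k d) (m n : ℕ) :
    S.P y k d (m+n) ↔ S.P y k d m ∧ S.P (S.Q y k d m) (k + m*d) d n := by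
  induction m generalizing y k with
  | zero => simp
  | succ m ih =>
    rw [show m + 1 + n = (m + n) + 1 by ring, P_succ, P_succ, Q_succ, ih, and_assoc]
    have : k + d + m * d = k + ((m+1 : ℕ) : ZMod (4*g)) * d := by push_cast; ring
    rw [this]

theorem P_mono {y : G} {k d} {m n : ℕ} (h : S.P y k d n) (hm : m ≤ n) : S.P y k d m := by
  obtain ⟨c, rfl⟩ := Nat.exists_eq_add_of_le hm
  exact ((S.P_add y k d m c).1 h).1

theorem e_inv' (k) : (S.e (k + S.T))⁻¹ = S.e k := by rw [S.e_inv, inv_inv]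

theorem ln_Q {y : G} {k d} {m : ℕ} (h : S.P y k d m) : S.ln (S.Q y k d m) + m = S.ln y := by
  induction m generalizing y k with
  | zero => simp
  | succ m ih =>
    have h1 := ih h.2
    have h2 : S.ln ((S.e k)⁻¹ * y) + 1 = S.ln y := h.1
    rw [Q_succ]; omega

theorem step_inv (k) (y : G) :
    S.ln ((S.e k)⁻¹ * y) = S.ln y + 1 ∨ S.ln ((S.e k)⁻¹ * y) + 1 = S.ln y := by
  rw [← S.e_inv]; exact S.step _ _

theorem not_D {y : G} {k} (h : ¬ S.D y k) : S.ln ((S.e k)⁻¹ * y) = S.ln y + 1 := by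
  rcases S.step_inv k y with h1 | h1
  · exact h1
  · exact absurd h1 h

theorem ln_Q_ge (y : G) (k d) (m : ℕ) : S.ln y ≤ S.ln (S.Q y k d m) + m := by
  induction m generalizing y k with
  | zero => simp
  | succ m ih =>
    have h1 := ih ((S.e k)⁻¹ * y) (k+d)
    rw [Q_succ]
    rcases S.step_inv k y with h | h <;> omega

theorem P_of_ln {y : G} {k d} {m : ℕ} (h : S.ln (S.Q y k d m) + m = S.ln y) : S.P y k d m := by
  induction m generalizing y k with
  | zero => trivial
  | succ m ih =>
    have h1 := S.ln_Q_ge ((S.e k)⁻¹ * y) (k+d) d m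
    rw [Q_succ] at h
    rcases S.step_inv k y with h2 | h2
    · omega
    · exact ⟨h2, ih (by omega)⟩

theorem not_back {y : G} {k} (h : S.D y k) : ¬ S.D ((S.e k)⁻¹ * y) (k + S.T) := by
  intro h1
  have h2 : S.ln ((S.e k)⁻¹ * y) + 1 = S.ln y := h
  have h3 : S.ln ((S.e (k + S.T))⁻¹ * ((S.e k)⁻¹ * y)) + 1 = S.ln ((S.e k)⁻¹ * y) := h1
  rw [S.e_inv'] at h3
  simp at h3
  omega

theorem D_back {y : G} {k} (h : ¬ S.D y k) : S.D ((S.e k)⁻¹ * y) (k + S.T) := by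
  have h1 := S.not_D h
  show S.ln ((S.e (k + S.T))⁻¹ * ((S.e k)⁻¹ * y)) + 1 = S.ln ((S.e k)⁻¹ * y)
  rw [S.e_inv']
  simp [h1]

/-- After stripping `m+1` letters, the back letter is not a descent. -/
theorem not_back_Q {y : G} {k d} {m : ℕ} (h : S.P y k d (m+1)) :
    ¬ S.D (S.Q y k d (m+1)) (k + m*d + S.T) := by
  have h1 := (S.P_add y k d m 1).1 h
  rw [P_one] at h1
  have := S.not_back h1.2
  rwa [Q_add]

theorem P_swap {y : G} {k d} (hd : d = 1 ∨ d = -1) (h : S.P y k d (2*g)) :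
    S.P y (k + S.T - d) (-d) (2*g) := by
  apply S.P_of_ln
  have := S.ln_Q h
  unfold Q at this ⊢
  rwa [← S.swap y k d hd]

theorem two {y : G} {k k'} (hk : S.D y k) (hk' : S.D y k') (hne : k ≠ k') :
    ∃ d, (d = 1 ∨ d = -1) ∧ k' = k + S.T - d ∧ S.P y k d (2*g) := by
  obtain ⟨d, h1, h2, h3⟩ := S.two' y k k' hne hk hk'
  exact ⟨d, h1, h2, S.P_of_ln h3⟩

theorem D_of_P {y : G} {k d} {m : ℕ} (hm : 1 ≤ m) (h : S.P y k d m) : S.D y k :=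
  (S.P_one y k d).1 (S.P_mono h hm)

theorem D_other {y : G} {k d} (hd : d = 1 ∨ d = -1) (h : S.P y k d (2*g)) :
    S.D y (k + S.T - d) :=
  S.D_of_P (by have := S.hg; omega) (S.P_swap hd h)

theorem D_second {y : G} {k d} {m : ℕ} (hm : 2 ≤ m) (h : S.P y k d m) :
    S.D ((S.e k)⁻¹ * y) (k + d) :=
  ((S.P_succ y k d 1).1 (S.P_mono h hm)).2.1

theorem no_opp {y : G} {k d} (hd : d = 1 ∨ d = -1) (h1 : S.D y (k + d)) (h2 : S.D y (k - d)) :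
    False := by
  have n2 := S.n2
  have n6 := S.n6
  have TT := S.TT
  have hne : k + d ≠ k - d := by rcases hd with rfl | rfl <;> grind
  obtain ⟨d', hd', h3, _⟩ := S.two h1 h2 hne
  rcases hd with rfl | rfl <;> rcases hd' with rfl | rfl <;> grind

/-- the other letters of `D y` lie next to a given one -/
theorem near {y : G} {k k'} (hk : S.D y k) (hk' : S.D y k') :
    k' = k ∨ k' = k + S.T - 1 ∨ k' = k + S.T + 1 := by
  by_cases h : k = k'
  · exact Or.inl h.symm
  obtain ⟨d, hd, h3, _⟩ := S.two hk hk' h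
  rcases hd with rfl | rfl
  · exact Or.inr (Or.inl h3)
  · right; right; rw [h3]; ring

/-- The condition guaranteeing additivity of lengths. -/
def C (x y : G) : Prop :=
  (∀ k, S.D x k → ¬ S.D y k) ∧
  ∀ a d m n, (d = 1 ∨ d = -1) → 1 ≤ m → 1 ≤ n → S.P x a d m → S.P y (a + S.T - d) (-d) n →
    m + n ≤ 2*g

theorem C_step {x y : G} (h : S.C x y) {a} (ha : S.D x a) :
    S.C ((S.e a)⁻¹ * x) ((S.e a)⁻¹ * y) := by
  have n2 := S.n2
  have n6 := S.n6
  have TT := S.TT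
  have hgg := S.hg
  have hay : ¬ S.D y a := h.1 a ha
  have hb := S.D_back hay
  have hxb := S.not_back ha
  set x1 := (S.e a)⁻¹ * x with hx1
  set y1 := (S.e a)⁻¹ * y with hy1
  have hyy : (S.e (a + S.T))⁻¹ * y1 = y := by rw [S.e_inv', hy1]; group
  -- analysis of a further letter of D y1
  have key : ∀ b, S.D y1 b → b ≠ a + S.T → ∃ d, (d = 1 ∨ d = -1) ∧ b = a + d ∧
      S.P y1 (a + S.T) (-d) (2*g) ∧ ¬ S.D x1 b := by
    intro b hb1 hne
    obtain ⟨d', hd', h3, h4⟩ := S.two hb hb1 (Ne.symm hne)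
    have hb2 : b = a + -d' := by rw [h3]; linear_combination TT
    refine ⟨-d', by rcases hd' with rfl | rfl <;> simp, hb2, by simpa using h4, ?_⟩
    intro hbx
    have h5 : S.P y1 (a + S.T) d' ((2*g-1)+1) := by
      rw [show 2*g-1+1 = 2*g by omega]; exact h4
    have h6 := ((S.P_succ _ _ _ _).1 h5).2
    rw [hyy] at h6
    have h7 : S.P x a (-d') 2 := by
      rw [P_succ, P_one]; refine ⟨ha, ?_⟩; rw [← hb2]; exact hbx
    have := h.2 a (-d') 2 (2*g-1) (by rcases hd' with rfl | rfl <;> simp) (by omega) (by omega) h7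
      (by simpa [sub_neg_eq_add] using h6)
    omega
  constructor
  · intro k hk hk2
    by_cases hka : k = a + S.T
    · subst hka; exact hxb hk
    · obtain ⟨d, _, _, _, h4⟩ := key k hk2 hka
      exact h4 hk
  · intro c d m n hd hm hn hP1 hP2
    by_contra hlt
    push Not at hlt
    by_cases hda : c + S.T - d = a + S.T
    · have hca : c = a + d := by linear_combination hda
      subst hca
      have hPx : S.P x a d (m+1) := ⟨ha, hP1⟩
      rw [hda] at hP2
      obtain ⟨n', rfl⟩ := Nat.exists_eq_add_of_le' hn
      have h6 := ((S.P_succ _ _ _ _).1 hP2).2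
      rw [hyy] at h6
      rcases Nat.eq_zero_or_pos n' with rfl | hn'
      · have h8 := S.D_other hd (S.P_mono hP1 (by omega : 2*g ≤ m))
        apply hxb
        convert h8 using 1
        ring
      · have := h.2 a d (m+1) n' hd (by omega) hn' hPx (by simpa [sub_eq_add_neg] using h6)
        omega
    · have hD := S.D_of_P hn hP2
      obtain ⟨d1, hd1, h2, h3, h4⟩ := key _ hD hda
      have hc := S.D_of_P hm hP1
      have hn1 : n = 1 := by
        by_contra hn1
        have h8 := S.D_second (by omega : 2 ≤ n) hP2
        have h9 := S.P_swap (by rcases hd1 with rfl | rfl <;> simp) h3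
        have h10 := S.D_second (by omega : 2 ≤ 2*g) h9
        have e1 : a + S.T + S.T - -d1 = c + S.T - d := by rw [h2]; linear_combination TT
        rw [e1] at h10
        have hca : c ≠ a + S.T := by rintro rfl; exact hxb hc
        have hdd : d = d1 := by
          rcases hd with rfl | rfl <;> rcases hd1 with rfl | rfl <;> first | rfl | (exfalso; grind)
        subst hdd
        refine S.no_opp hd (y := (S.e (c + S.T - d))⁻¹ * y1) (k := c + S.T - d) ?_ ?_
        · simpa using h10
        · simpa [sub_eq_add_neg] using h8
      subst hn1
      exact h4 (S.D_other hd (S.P_mono hP1 (by omega : 2*g ≤ m)))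

theorem C_add {x y : G} (h : S.C x y) : S.ln (x⁻¹ * y) = S.ln x + S.ln y := by
  induction hn : S.ln x generalizing x y with
  | zero =>
    have : x = 1 := by
      by_contra hx
      obtain ⟨k, hk⟩ := S.exists_desc x hx
      unfold Dsc at hk; omega
    subst this; simp
  | succ n ih =>
    have hx : x ≠ 1 := by rintro rfl; rw [S.ln_one] at hn; omega
    obtain ⟨a, ha⟩ := S.exists_desc x hx
    have h1 := S.C_step h ha
    have h2 := ih h1 (by unfold Dsc at ha; omega)
    have h3 := S.not_D (h.1 a ha)
    rw [h3] at h2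
    have : ((S.e a)⁻¹ * x)⁻¹ * ((S.e a)⁻¹ * y) = x⁻¹ * y := by group
    rw [this] at h2
    omega

/-- vacuous case -/
theorem C_vac {x y : G} (h : ∀ a b, S.D x a → S.D y b →
    b ≠ a ∧ b ≠ a + S.T - 1 ∧ b ≠ a + S.T + 1) : S.C x y := by
  constructor
  · intro k h1 h2
    exact (h k k h1 h2).1 rfl
  · intro a d m n hd hm hn h1 h2
    have := h _ _ (S.D_of_P hm h1) (S.D_of_P hn h2)
    rcases hd with rfl | rfl
    · exact absurd rfl this.2.1
    · exact absurd (by ring) this.2.2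

theorem C_K {x y : G} {s d} (hd : d = 1 ∨ d = -1) (hP : S.P y s d 2) (h1 : ¬ S.D x s)
    (h2 : ¬ S.D x (s + S.T - d)) : S.C x y := by
  have n2 := S.n2
  have n6 := S.n6
  have TT := S.TT
  have hgg := S.hg
  have hs := S.D_of_P (by omega) hP
  have hs2 := S.D_second le_rfl hP
  have key : ∀ b, S.D y b → b ≠ s → b = s + S.T - d ∧ S.P y s d (2*g) := by
    intro b hb hne
    obtain ⟨d', hd', h3, h4⟩ := S.two hs hb (Ne.symm hne)
    by_cases hdd : d' = d
    · subst hdd; exact ⟨h3, h4⟩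
    · exfalso
      have : d' = -d := by
        rcases hd with rfl | rfl <;> rcases hd' with rfl | rfl <;> simp_all
      subst this
      have h5 := S.D_second (by omega : 2 ≤ 2*g) h4
      exact S.no_opp hd hs2 (by simpa [sub_eq_add_neg] using h5)
  constructor
  · intro k hk hk2
    by_cases hks : k = s
    · subst hks; exact h1 hk
    · obtain ⟨rfl, _⟩ := key k hk2 hks
      exact h2 hk
  · intro a d' m n hd' hm hn hP1 hP2
    by_contra hlt
    push Not at hlt
    have ha := S.D_of_P hm hP1
    have hb := S.D_of_P hn hP2
    have hn2 : 2 ≤ n := by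
      by_contra hn2
      have h8 := S.D_other hd' (S.P_mono hP1 (by omega : 2*g ≤ m))
      by_cases hks : a + S.T - d' = s
      · rw [hks] at h8; exact h1 h8
      · obtain ⟨h9, _⟩ := key _ hb hks
        rw [h9] at h8; exact h2 h8
    have h8 := S.D_second hn2 hP2
    by_cases hks : a + S.T - d' = s
    · have : d' = d := by
        by_contra hne
        have : d' = -d := by
          rcases hd with rfl | rfl <;> rcases hd' with rfl | rfl <;> simp_all
        subst this
        apply h2
        convert ha using 1
        rw [← hks]; linear_combination TT
      subst this
      rw [hks] at h8
      exact S.no_opp hd hs2 (by simpa [sub_eq_add_neg] using h8)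
    · obtain ⟨h9, h10⟩ := key _ hb hks
      have hne : d' ≠ d := by
        rintro rfl
        apply h1
        convert ha using 1
        linear_combination -h9
      have : d' = -d := by
        rcases hd with rfl | rfl <;> rcases hd' with rfl | rfl <;> simp_all
      subst this
      have h11 := S.D_second (by omega : 2 ≤ 2*g) (S.P_swap hd h10)
      rw [h9] at h8
      refine S.no_opp hd (y := (S.e (s + S.T - d))⁻¹ * y) (k := s + S.T - d) ?_ ?_
      · simpa using h8
      · simpa [sub_eq_add_neg] using h11

end GSys

end Abstract

end SG
namespace SG

section Abstract2

/-- the list `k, k+d, …` of length `m` -/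
def fl {g : ℕ} : ZMod (4*g) → ZMod (4*g) → ℕ → List (ZMod (4*g))
  | _, _, 0 => []
  | k, d, m + 1 => k :: fl (k + d) d m

theorem length_fl {g : ℕ} (k d : ZMod (4*g)) (m : ℕ) : (fl k d m).length = m := by
  induction m generalizing k with
  | zero => rfl
  | succ m ih => simp [fl, ih]

theorem fl_add {g : ℕ} (k d : ZMod (4*g)) (m n : ℕ) :
    fl k d (m + n) = fl k d m ++ fl (k + (m : ZMod (4*g))*d) d n := by
  induction m generalizing k with
  | zero => simp [fl]
  | succ m ih =>
    rw [show m + 1 + n = (m + n) + 1 by ring]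
    simp only [fl, List.cons_append]
    rw [ih]
    congr 3
    push_cast; ring

theorem fl_initial {g : ℕ} (k d : ZMod (4*g)) {m n : ℕ} (h : m ≤ n) : fl k d m <+: fl k d n := by
  obtain ⟨c, rfl⟩ := Nat.exists_eq_add_of_le h
  rw [fl_add]
  exact List.prefix_append _ _

variable {g : ℕ} {G : Type*} [Group G]

namespace GSys

variable (S : GSys g G)

/-- `ks` is a geodesic word for `x` -/
def Geo (ks : List (ZMod (4*g))) (x : G) : Prop :=
  (ks.map S.e).prod = x ∧ S.ln x = ks.length

theorem ln_prod_le (ks : List (ZMod (4*g))) : S.ln (ks.map S.e).prod ≤ ks.length := by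
  induction ks with
  | nil => simp [S.ln_one]
  | cons k ks ih =>
    simp only [List.map_cons, List.prod_cons, List.length_cons]
    rcases S.step k (ks.map S.e).prod with h | h <;> omega

theorem Geo_cons {k ks x} (h : S.Geo (k :: ks) x) : S.D x k ∧ S.Geo ks ((S.e k)⁻¹ * x) := by
  obtain ⟨h1, h2⟩ := h
  subst h1
  simp only [List.map_cons, List.prod_cons, List.length_cons] at h2
  have h3 := S.ln_prod_le ks
  have h4 := S.step k (ks.map S.e).prod
  unfold D Dsc Geo
  simp only [List.map_cons, List.prod_cons, inv_mul_cancel_left, true_and]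
  omega

theorem lemL {M : ℕ} {k d} (hd : d = 1 ∨ d = -1) {ks x} (hx : S.Geo ks x) (hP : S.P x k d M)
    (hb : ¬ S.D x (k + S.T - d)) :
    fl k d M <+: ks ∨ ∃ M', M = M' + 1 ∧ fl k d M' <+: ks ∧
      S.D (S.Q x k d (M'+1)) (k + M'*d - d) := by
  induction M generalizing x k ks with
  | zero => left; exact ⟨_, rfl⟩
  | succ N ih =>
    obtain ⟨hk, hP'⟩ := (S.P_succ _ _ _ _).1 hP
    cases ks with
    | nil =>
      exfalso
      have h1 := hx.2
      have h2 : S.ln ((S.e k)⁻¹ * x) + 1 = S.ln x := hk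
      simp at h1
      omega
    | cons c ks =>
      obtain ⟨hc, hx'⟩ := S.Geo_cons hx
      by_cases hck : c = k
      · subst hck
        have hb' : ¬ S.D ((S.e c)⁻¹ * x) (c + d + S.T - d) := by
          have := S.not_back hk
          rwa [show c + d + S.T - d = c + S.T by ring]
        rcases ih hx' hP' hb' with h | ⟨M', rfl, h1, h2⟩
        · left
          simpa [fl] using h
        · right
          refine ⟨M' + 1, rfl, by simpa [fl] using h1, ?_⟩
          rw [Q_succ]
          convert h2 using 1
          push_cast; ring
      · right
        obtain ⟨d', hd', h3, h4⟩ := S.two hk hc (Ne.symm hck)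
        have : d' = -d := by
          have : d' ≠ d := by rintro rfl; rw [h3] at hc; exact hb hc
          rcases hd with rfl | rfl <;> rcases hd' with rfl | rfl <;> simp_all
        subst this
        have h5 := S.D_second (by have := S.hg; omega : 2 ≤ 2*g) h4
        have hN : N = 0 := by
          by_contra hN
          have h6 := S.D_of_P (by omega) hP'
          exact S.no_opp hd h6 (by simpa [sub_eq_add_neg] using h5)
        subst hN
        refine ⟨0, rfl, ⟨_, rfl⟩, ?_⟩
        rw [Q_succ, Q_zero]
        convert h5 using 1
        push_cast; ring

theorem lemL1 {M : ℕ} {k d} (hd : d = 1 ∨ d = -1) {ks x} (hx : S.Geo (k :: ks) x)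
    (hP : S.P x k d (M+2)) :
    fl k d (M+2) <+: (k :: ks) ∨ (fl k d (M+1) <+: (k :: ks) ∧
      S.D (S.Q x k d (M+2)) (k + M*d)) := by
  obtain ⟨hk, hP'⟩ := (S.P_succ _ _ _ _).1 hP
  obtain ⟨hc, hx'⟩ := S.Geo_cons hx
  have hb' : ¬ S.D ((S.e k)⁻¹ * x) (k + d + S.T - d) := by
    have := S.not_back hk
    rwa [show k + d + S.T - d = k + S.T by ring]
  rcases S.lemL hd hx' hP' hb' with h | ⟨M', h0, h1, h2⟩
  · left
    simpa [fl] using h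
  · right
    obtain rfl : M = M' := by omega
    refine ⟨by simpa [fl] using h1, ?_⟩
    rw [Q_succ]
    convert h2 using 1
    ring

theorem Q_Q (x y : G) (k d) (m : ℕ) : (S.Q x k d m)⁻¹ * S.Q y k d m = x⁻¹ * y := by
  induction m generalizing x y k with
  | zero => rfl
  | succ m ih => rw [Q_succ, Q_succ, ih]; group

theorem lemLL {x y : G} {k d} {m : ℕ} (hd : d = 1 ∨ d = -1) (hy : S.P y k d (2*g))
    (hx : S.P x k d m) (hx' : ¬ S.P x k d (m+1)) (hm : m + 2 ≤ 2*g)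
    (hb : ¬ S.D x (k + S.T - d)) : S.ln x + S.ln y ≤ S.ln (x⁻¹ * y) + 2*m := by
  have h1 := S.ln_Q hx
  have h2 := S.ln_Q (S.P_mono hy (by omega : m ≤ 2*g))
  have h3 : S.P (S.Q y k d m) (k + m*d) d 2 := ((S.P_add y k d m 2).1 (S.P_mono hy hm)).2
  have h4 : ¬ S.D (S.Q x k d m) (k + m*d) := by
    intro h
    apply hx'
    rw [P_add, P_one]
    exact ⟨hx, h⟩
  have h5 : ¬ S.D (S.Q x k d m) (k + m*d + S.T - d) := by
    cases m with
    | zero => simpa using hb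
    | succ m =>
      have := S.not_back_Q hx
      convert this using 2
      push_cast; ring
  have h6 := S.C_add (S.C_K hd h3 h4 h5)
  rw [Q_Q] at h6
  omega

theorem exists_max (x : G) (k d) {N : ℕ} (h : ¬ S.P x k d N) :
    ∃ m, m < N ∧ S.P x k d m ∧ ¬ S.P x k d (m+1) := by
  induction N with
  | zero => exact absurd trivial h
  | succ N ih =>
    by_cases h1 : S.P x k d N
    · exact ⟨N, by omega, h1, h⟩
    · obtain ⟨m, h2, h3⟩ := ih h1
      exact ⟨m, by omega, h3⟩

theorem Q_last (y : G) (k d) (m : ℕ) :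
    S.Q y k d (m+1) = (S.e (k + m*d))⁻¹ * S.Q y k d m := by
  rw [Q_add]; rfl

theorem Q_undo (y : G) (a d) (j : ℕ) :
    S.Q (S.Q y a d j) (a + j*d - d + S.T) (-d) j = y := by
  induction j with
  | zero => rfl
  | succ j ih =>
    have e1 : a + ((j+1 : ℕ) : ZMod (4*g)) * d - d + S.T = a + j*d + S.T := by push_cast; ring
    rw [e1, Q_succ, Q_last, S.e_inv', mul_inv_cancel_left]
    convert ih using 2
    ring

/-- Case B : disjoint descents -/
theorem caseB {x y : G} (hdis : ∀ k, S.D x k → ¬ S.D y k) :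
    S.ln x + S.ln y ≤ S.ln (x⁻¹ * y) + 4*g := by
  have TT := S.TT
  have hgg := S.hg
  by_cases hC : S.C x y
  · have := S.C_add hC
    omega
  · have : ∃ a d m n, (d = 1 ∨ d = -1) ∧ 1 ≤ m ∧ 1 ≤ n ∧ S.P x a d m ∧
        S.P y (a + S.T - d) (-d) n ∧ 2*g < m + n := by
      by_contra hcon
      apply hC
      refine ⟨hdis, ?_⟩
      intro a d m n hd hm hn h1 h2
      by_contra hlt
      exact hcon ⟨a, d, m, n, hd, hm, hn, h1, h2, by omega⟩
    obtain ⟨a, d, m, n0, hd, hm, hn0, hP1, hP2, hlt⟩ := this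
    have hd' : -d = 1 ∨ -d = -1 := by rcases hd with rfl | rfl <;> simp
    have haD := S.D_of_P hm hP1
    have hx2g : ¬ S.P x a d (2*g) := fun h =>
      hdis _ (S.D_other hd h) (S.D_of_P hn0 hP2)
    have hy2g : ¬ S.P y (a + S.T - d) (-d) (2*g) := fun h => by
      have h1 := S.D_other hd' h
      apply hdis _ haD
      convert h1 using 1
      linear_combination -TT
    obtain ⟨n, hn1, hn2, hn3⟩ := S.exists_max _ _ _ hy2g
    have hnn : n0 ≤ n := by
      by_contra hh
      exact hn3 (S.P_mono hP2 (by omega))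
    have hm2 : m < 2*g := by
      by_contra hh
      exact hx2g (S.P_mono hP1 (by omega))
    have key : ∀ j, j ≤ 2*g - n → S.ln (S.Q y a d j) = S.ln y + j ∧
        S.P (S.Q y a d j) (a + j*d - d + S.T) (-d) (n+j) := by
      intro j
      induction j with
      | zero =>
        intro _
        refine ⟨rfl, ?_⟩
        rw [show a + ((0 : ℕ) : ZMod (4*g)) * d - d + S.T = a + S.T - d by push_cast; ring]
        exact hn2
      | succ j ih =>
        intro hj
        obtain ⟨h1, h2⟩ := ih (by omega)
        have h3 : ¬ S.D (S.Q y a d j) (a + j*d) := by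
          intro h4
          have h5 := S.D_of_P (by omega) h2
          have hne : a + j*d ≠ a + j*d - d + S.T := by
            intro h
            have n2 := S.n2
            rcases hd with rfl | rfl <;> grind
          obtain ⟨d', hd'', h6, h7⟩ := S.two h4 h5 hne
          have : d' = d := by linear_combination h6
          subst this
          have h8 := S.P_swap hd h7
          have h9 : S.P (S.Q y a d' j) (a + j*d' - d' + S.T) (-d') (j + (n+1)) := by
            rw [h6]
            exact S.P_mono h8 (by omega)
          have h10 := ((S.P_add _ _ _ _ _).1 h9).2
          rw [Q_undo] at h10
          apply hn3
          convert h10 using 1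
          ring
        have h4 := S.not_D h3
        have h5 := S.D_back h3
        have e1 : a + ((j+1 : ℕ) : ZMod (4*g)) * d - d + S.T = a + j*d + S.T := by push_cast; ring
        rw [e1, Q_last]
        refine ⟨by omega, ?_⟩
        rw [show n + (j+1) = (n+j)+1 by ring, P_succ]
        refine ⟨h5, ?_⟩
        rw [S.e_inv', mul_inv_cancel_left]
        convert h2 using 1
        ring
    obtain ⟨h1, h2⟩ := key (2*g-n) le_rfl
    set j := 2*g - n with hj
    rw [show n + j = 2*g by omega] at h2
    have h3 := S.P_swap hd' h2
    rw [neg_neg, show a + j*d - d + S.T + S.T - -d = a + j*d by linear_combination TT] at h3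
    have h4 : S.P x a d j := S.P_mono hP1 (by omega)
    have h5 : ¬ S.P (S.Q x a d j) (a + j*d) d (2*g-1) := by
      intro h
      apply hx2g
      have : S.P x a d (j + (2*g-1)) := (S.P_add _ _ _ _ _).2 ⟨h4, h⟩
      exact S.P_mono this (by omega)
    obtain ⟨m', h6, h7, h8⟩ := S.exists_max _ _ _ h5
    have h9 : ¬ S.D (S.Q x a d j) (a + j*d + S.T - d) := by
      obtain ⟨j', hj'⟩ : ∃ j', j = j' + 1 := ⟨j-1, by omega⟩
      rw [hj'] at h4 ⊢
      have := S.not_back_Q h4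
      convert this using 2
      push_cast; ring
    have h10 := S.lemLL hd h3 h7 h8 (by omega) h9
    rw [Q_Q] at h10
    have h11 := S.ln_Q h4
    omega

end GSys

end Abstract2

end SG
namespace SG

section Abstract3

variable {g : ℕ} {G : Type*} [Group G]

/-- pure arithmetic in `ZMod (4g)`, used for one vacuous case -/
theorem arith_aux {R : Type*} [CommRing R] {T h : R} (TT : T + T = 0) (n2 : (2 : R) ≠ 0)
    (n4 : (4 : R) ≠ 0) (n6 : (6 : R) ≠ 0) (n10 : (10 : R) ≠ 0) (c : ℤ) (b : Bool)
    (hc : h = c + if b then T else 0)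
    (hc' : if b then c = 1 ∨ c = -1 ∨ c = 3 ∨ c = -3 ∨ c = 5 ∨ c = -5 else
      c = 2 ∨ c = -2 ∨ c = 4 ∨ c = -4 ∨ c = 6 ∨ c = -6) : h ≠ 0 := by
  intro h0
  rw [h0] at hc
  cases b
  · simp only [Bool.false_eq_true, if_false] at hc hc'
    rcases hc' with rfl | rfl | rfl | rfl | rfl | rfl <;> push_cast at hc
    · exact n2 (by linear_combination -hc)
    · exact n2 (by linear_combination hc)
    · exact n4 (by linear_combination -hc)
    · exact n4 (by linear_combination hc)
    · exact n6 (by linear_combination -hc)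
    · exact n6 (by linear_combination hc)
  · simp only [if_true] at hc hc'
    rcases hc' with rfl | rfl | rfl | rfl | rfl | rfl <;> push_cast at hc
    · exact n2 (by linear_combination -2 * hc - TT)
    · exact n2 (by linear_combination 2 * hc + TT)
    · exact n6 (by linear_combination -2 * hc - TT)
    · exact n6 (by linear_combination 2 * hc + TT)
    · exact n10 (by linear_combination -2 * hc - TT)
    · exact n10 (by linear_combination 2 * hc + TT)

namespace GSys

variable (S : GSys g G)

theorem cast_sub {c : ℕ} (hc : c ≤ 2*g) : ((2*g - c : ℕ) : ZMod (4*g)) = S.T - c := by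
  rw [Nat.cast_sub hc, S.T_def]

theorem T_mul {d : ZMod (4*g)} (hd : d = 1 ∨ d = -1) : S.T * d = S.T := by
  have TT := S.TT
  rcases hd with rfl | rfl
  · ring
  · linear_combination -TT

/-- The hypothesis on literal subwords. -/
def Hyp (ks ls : List (ZMod (4*g))) : Prop :=
  ∀ k d, (d = 1 ∨ d = -1) →
    ¬ (fl k d (2*g) <+: ks ∧ fl (k + S.T - d) (-d) (2*g-1) <+: ls) ∧
    ¬ (fl k d (2*g-1) <+: ks ∧ fl (k + S.T - d) (-d) (2*g) <+: ls)

theorem Hyp_symm {ks ls} (h : S.Hyp ks ls) : S.Hyp ls ks := by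
  intro k d hd
  have hd' : -d = 1 ∨ -d = -1 := by rcases hd with rfl | rfl <;> simp
  have h1 := h (k + S.T - d) (-d) hd'
  rw [neg_neg, show k + S.T - d + S.T - -d = k by linear_combination S.TT] at h1
  exact ⟨fun h2 => h1.2 ⟨h2.2, h2.1⟩, fun h2 => h1.1 ⟨h2.2, h2.1⟩⟩

set_option linter.unusedSimpArgs false
theorem pm_neg {d d1 : ZMod (4*g)} (hd : d = 1 ∨ d = -1) (hd1 : d1 = 1 ∨ d1 = -1)
    (h : d1 ≠ d) : d1 = -d := by
  rcases hd with rfl | rfl <;> rcases hd1 with rfl | rfl <;> simp at h ⊢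

theorem vac {x y : G} {a0 b0 d} (hd : d = 1 ∨ d = -1) (hDx : S.D x a0) (hDy : S.D y b0)
    (bx : ¬ S.D x (a0 + S.T + d)) (bz : ¬ S.D y (b0 + S.T - d))
    (hab : b0 = a0 + 2*d ∨ b0 = a0 + S.T + 3*d) : S.C x y := by
  have TT := S.TT
  have A : ∀ (u v : ZMod (4*g)) (c : ℤ) (b : Bool), u - v = c + (if b then S.T else 0) →
      (if b then c = 1 ∨ c = -1 ∨ c = 3 ∨ c = -3 ∨ c = 5 ∨ c = -5 else
        c = 2 ∨ c = -2 ∨ c = 4 ∨ c = -4 ∨ c = 6 ∨ c = -6) → u ≠ v := fun u v c b h1 h2 =>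
    sub_ne_zero.1 (arith_aux TT S.n2 S.n4 S.n6 S.n10 c b h1 h2)
  apply S.C_vac
  intro a b ha hb
  have pa : a = a0 ∨ a = a0 + S.T - d := by
    have ha1 := S.near hDx ha
    have ha2 : a ≠ a0 + S.T + d := by rintro rfl; exact bx ha
    rcases hd with rfl | rfl <;> rcases ha1 with h | h | h
    · left; exact h
    · right; exact h
    · exact absurd h ha2
    · left; exact h
    · exact absurd (by linear_combination h) ha2
    · right; linear_combination h
  have pb : b = b0 ∨ b = b0 + S.T + d := by
    have hb1 := S.near hDy hb
    have hb2 : b ≠ b0 + S.T - d := by rintro rfl; exact bz hb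
    rcases hd with rfl | rfl <;> rcases hb1 with h | h | h
    · left; exact h
    · exact absurd h hb2
    · right; exact h
    · left; exact h
    · right; linear_combination h
    · exact absurd (by linear_combination h) hb2
  clear hDx hDy bx bz ha hb
  rcases hd with rfl | rfl <;> rcases hab with rfl | rfl <;> rcases pa with rfl | rfl <;>
    rcases pb with rfl | rfl
  · refine ⟨A _ _ (2) false (by simp only [if_true, if_false, Bool.false_eq_true]; push_cast; linear_combination (0) * TT) (by decide),
      A _ _ (3) true (by simp only [if_true, if_false, Bool.false_eq_true]; push_cast; linear_combination (-1) * TT) (by decide),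
      A _ _ (1) true (by simp only [if_true, if_false, Bool.false_eq_true]; push_cast; linear_combination (-1) * TT) (by decide)⟩
  · refine ⟨A _ _ (3) true (by simp only [if_true, if_false, Bool.false_eq_true]; push_cast; linear_combination (0) * TT) (by decide),
      A _ _ (4) false (by simp only [if_true, if_false, Bool.false_eq_true]; push_cast; linear_combination (0) * TT) (by decide),
      A _ _ (2) false (by simp only [if_true, if_false, Bool.false_eq_true]; push_cast; linear_combination (0) * TT) (by decide)⟩
  · refine ⟨A _ _ (3) true (by simp only [if_true, if_false, Bool.false_eq_true]; push_cast; linear_combination (-1) * TT) (by decide),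
      A _ _ (4) false (by simp only [if_true, if_false, Bool.false_eq_true]; push_cast; linear_combination (-1) * TT) (by decide),
      A _ _ (2) false (by simp only [if_true, if_false, Bool.false_eq_true]; push_cast; linear_combination (-1) * TT) (by decide)⟩
  · refine ⟨A _ _ (4) false (by simp only [if_true, if_false, Bool.false_eq_true]; push_cast; linear_combination (0) * TT) (by decide),
      A _ _ (5) true (by simp only [if_true, if_false, Bool.false_eq_true]; push_cast; linear_combination (-1) * TT) (by decide),
      A _ _ (3) true (by simp only [if_true, if_false, Bool.false_eq_true]; push_cast; linear_combination (-1) * TT) (by decide)⟩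
  · refine ⟨A _ _ (3) true (by simp only [if_true, if_false, Bool.false_eq_true]; push_cast; linear_combination (0) * TT) (by decide),
      A _ _ (4) false (by simp only [if_true, if_false, Bool.false_eq_true]; push_cast; linear_combination (0) * TT) (by decide),
      A _ _ (2) false (by simp only [if_true, if_false, Bool.false_eq_true]; push_cast; linear_combination (0) * TT) (by decide)⟩
  · refine ⟨A _ _ (4) false (by simp only [if_true, if_false, Bool.false_eq_true]; push_cast; linear_combination (1) * TT) (by decide),
      A _ _ (5) true (by simp only [if_true, if_false, Bool.false_eq_true]; push_cast; linear_combination (0) * TT) (by decide),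
      A _ _ (3) true (by simp only [if_true, if_false, Bool.false_eq_true]; push_cast; linear_combination (0) * TT) (by decide)⟩
  · refine ⟨A _ _ (4) false (by simp only [if_true, if_false, Bool.false_eq_true]; push_cast; linear_combination (0) * TT) (by decide),
      A _ _ (5) true (by simp only [if_true, if_false, Bool.false_eq_true]; push_cast; linear_combination (-1) * TT) (by decide),
      A _ _ (3) true (by simp only [if_true, if_false, Bool.false_eq_true]; push_cast; linear_combination (-1) * TT) (by decide)⟩
  · refine ⟨A _ _ (5) true (by simp only [if_true, if_false, Bool.false_eq_true]; push_cast; linear_combination (0) * TT) (by decide),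
      A _ _ (6) false (by simp only [if_true, if_false, Bool.false_eq_true]; push_cast; linear_combination (0) * TT) (by decide),
      A _ _ (4) false (by simp only [if_true, if_false, Bool.false_eq_true]; push_cast; linear_combination (0) * TT) (by decide)⟩
  · refine ⟨A _ _ (-2) false (by simp only [if_true, if_false, Bool.false_eq_true]; push_cast; linear_combination (0) * TT) (by decide),
      A _ _ (-1) true (by simp only [if_true, if_false, Bool.false_eq_true]; push_cast; linear_combination (-1) * TT) (by decide),
      A _ _ (-3) true (by simp only [if_true, if_false, Bool.false_eq_true]; push_cast; linear_combination (-1) * TT) (by decide)⟩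
  · refine ⟨A _ _ (-3) true (by simp only [if_true, if_false, Bool.false_eq_true]; push_cast; linear_combination (0) * TT) (by decide),
      A _ _ (-2) false (by simp only [if_true, if_false, Bool.false_eq_true]; push_cast; linear_combination (0) * TT) (by decide),
      A _ _ (-4) false (by simp only [if_true, if_false, Bool.false_eq_true]; push_cast; linear_combination (0) * TT) (by decide)⟩
  · refine ⟨A _ _ (-3) true (by simp only [if_true, if_false, Bool.false_eq_true]; push_cast; linear_combination (-1) * TT) (by decide),
      A _ _ (-2) false (by simp only [if_true, if_false, Bool.false_eq_true]; push_cast; linear_combination (-1) * TT) (by decide),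
      A _ _ (-4) false (by simp only [if_true, if_false, Bool.false_eq_true]; push_cast; linear_combination (-1) * TT) (by decide)⟩
  · refine ⟨A _ _ (-4) false (by simp only [if_true, if_false, Bool.false_eq_true]; push_cast; linear_combination (0) * TT) (by decide),
      A _ _ (-3) true (by simp only [if_true, if_false, Bool.false_eq_true]; push_cast; linear_combination (-1) * TT) (by decide),
      A _ _ (-5) true (by simp only [if_true, if_false, Bool.false_eq_true]; push_cast; linear_combination (-1) * TT) (by decide)⟩
  · refine ⟨A _ _ (-3) true (by simp only [if_true, if_false, Bool.false_eq_true]; push_cast; linear_combination (0) * TT) (by decide),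
      A _ _ (-2) false (by simp only [if_true, if_false, Bool.false_eq_true]; push_cast; linear_combination (0) * TT) (by decide),
      A _ _ (-4) false (by simp only [if_true, if_false, Bool.false_eq_true]; push_cast; linear_combination (0) * TT) (by decide)⟩
  · refine ⟨A _ _ (-4) false (by simp only [if_true, if_false, Bool.false_eq_true]; push_cast; linear_combination (1) * TT) (by decide),
      A _ _ (-3) true (by simp only [if_true, if_false, Bool.false_eq_true]; push_cast; linear_combination (0) * TT) (by decide),
      A _ _ (-5) true (by simp only [if_true, if_false, Bool.false_eq_true]; push_cast; linear_combination (0) * TT) (by decide)⟩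
  · refine ⟨A _ _ (-4) false (by simp only [if_true, if_false, Bool.false_eq_true]; push_cast; linear_combination (0) * TT) (by decide),
      A _ _ (-3) true (by simp only [if_true, if_false, Bool.false_eq_true]; push_cast; linear_combination (-1) * TT) (by decide),
      A _ _ (-5) true (by simp only [if_true, if_false, Bool.false_eq_true]; push_cast; linear_combination (-1) * TT) (by decide)⟩
  · refine ⟨A _ _ (-5) true (by simp only [if_true, if_false, Bool.false_eq_true]; push_cast; linear_combination (0) * TT) (by decide),
      A _ _ (-4) false (by simp only [if_true, if_false, Bool.false_eq_true]; push_cast; linear_combination (0) * TT) (by decide),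
      A _ _ (-6) false (by simp only [if_true, if_false, Bool.false_eq_true]; push_cast; linear_combination (0) * TT) (by decide)⟩

theorem caseA3 {x y : G} {i j k} (hij : i ≠ j) (hi : S.D x i) (hj : S.D y j)
    (hiy : ¬ S.D y i) (hjx : ¬ S.D x j) (hkx : S.D x k) (hky : S.D y k) :
    S.ln x + S.ln y ≤ S.ln (x⁻¹ * y) + 4*g := by
  have TT := S.TT
  have hgg := S.hg
  have n2 := S.n2
  have n4 := S.n4
  have n6 := S.n6
  have n10 := S.n10
  have hki : k ≠ i := by rintro rfl; exact hiy hky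
  have hkj : k ≠ j := by rintro rfl; exact hjx hkx
  obtain ⟨d, hd, h1, h2⟩ := S.two hkx hi hki
  obtain ⟨d', hd', h3, h4⟩ := S.two hky hj hkj
  have : d' = -d := by
    have : d' ≠ d := by rintro rfl; exact hij (h1.trans h3.symm)
    rcases hd with rfl | rfl <;> rcases hd' with rfl | rfl <;> simp_all
  subst this
  have h5 := S.D_second (by omega : 2 ≤ 2*g) h2
  have h6 := S.D_second (by omega : 2 ≤ 2*g) h4
  have h7 := S.not_back hkx
  have h8 := S.not_back hky
  have hC : S.C ((S.e k)⁻¹ * x) ((S.e k)⁻¹ * y) := by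

    refine S.vac hd' h5 h6 ?_ ?_ (Or.inl (by ring))
    · rwa [show k + d + S.T + -d = k + S.T by ring]
    · rwa [show k + -d + S.T - -d = k + S.T by ring]
  have h9 := S.C_add hC
  have e1 : ((S.e k)⁻¹ * x)⁻¹ * ((S.e k)⁻¹ * y) = x⁻¹ * y := by group
  rw [e1] at h9
  have h10 : S.ln ((S.e k)⁻¹ * x) + 1 = S.ln x := hkx
  have h11 : S.ln ((S.e k)⁻¹ * y) + 1 = S.ln y := hky
  omega

theorem caseA1 {x y : G} {i j ks ls} (hij : i ≠ j) (hx : S.Geo (i :: ks) x)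
    (hy : S.Geo (j :: ls) y) (H : S.Hyp (i :: ks) (j :: ls)) (hiy : S.D y i) :
    S.ln x + S.ln y ≤ S.ln (x⁻¹ * y) + 4*g := by
  have TT := S.TT
  have hgg := S.hg
  have n2 := S.n2
  have n4 := S.n4
  have n6 := S.n6
  have n10 := S.n10
  have hix := (S.Geo_cons hx).1
  have hjy := (S.Geo_cons hy).1
  obtain ⟨d, hd, hj, hPy⟩ := S.two hiy hjy hij
  have hTd := S.T_mul hd
  have hd' : -d = 1 ∨ -d = -1 := by rcases hd with rfl | rfl <;> simp
  have hPy' := S.P_swap hd hPy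
  rw [← hj] at hPy'
  have hQy : S.Q y i d (2*g) = S.Q y j (-d) (2*g) := by
    rw [hj]; exact S.swap y i d hd
  have c1 : ((2*g-1 : ℕ) : ZMod (4*g)) = S.T - 1 := by
    rw [S.cast_sub (by omega)]; norm_num
  have c2 : ((2*g-2 : ℕ) : ZMod (4*g)) = S.T - 2 := by
    rw [S.cast_sub (by omega)]; norm_num
  have c3 : ((2*g-3 : ℕ) : ZMod (4*g)) = S.T - 3 := by
    rw [S.cast_sub (by omega)]; norm_num
  have s1 : 2*g-1+1 = 2*g := by omega
  have s2 : 2*g-2+2 = 2*g := by omega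
  have s2' : 2*g-2+1 = 2*g-1 := by omega
  have s3 : 2*g-3+2 = 2*g-1 := by omega
  -- literal analysis of y
  have Ly : fl j (-d) (2*g) <+: (j :: ls) ∨ (fl j (-d) (2*g-1) <+: (j :: ls) ∧
      S.D (S.Q y i d (2*g)) (i + d)) := by
    have h := S.lemL1 (M := 2*g-2) hd' hy (by rw [s2]; exact hPy')
    rw [s2, s2', c2] at h
    rw [hQy]
    convert h using 3
    rw [hj]; linear_combination hTd
  by_cases hjx : S.D x j
  · obtain ⟨d0, hd0, hj0, hPx⟩ := S.two hix hjx hij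
    obtain rfl : d0 = d := by linear_combination hj0 - hj
    have hPx' := S.P_swap hd hPx
    rw [← hj] at hPx'
    have hQx : S.Q x i d0 (2*g) = S.Q x j (-d0) (2*g) := by
      rw [hj]; exact S.swap x i d0 hd
    have Lx : fl i d0 (2*g) <+: (i :: ks) ∨ (fl i d0 (2*g-1) <+: (i :: ks) ∧
        S.D (S.Q x i d0 (2*g)) (j - d0)) := by
      have h := S.lemL1 (M := 2*g-2) hd hx (by rw [s2]; exact hPx)
      rw [s2, s2', c2] at h
      convert h using 3
      rw [hj]; linear_combination -hTd
    have bk1 : ∀ z, S.P z i d0 (2*g) → ¬ S.D (S.Q z i d0 (2*g)) (i - d0) := by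
      intro z hz
      have h := S.not_back_Q (m := 2*g-1) (by rw [s1]; exact hz)
      rw [s1, c1] at h
      convert h using 2
      linear_combination -TT - hTd
    have bk2 : ∀ z, S.P z j (-d0) (2*g) → ¬ S.D (S.Q z j (-d0) (2*g)) (i + S.T) := by
      intro z hz
      have h := S.not_back_Q (m := 2*g-1) (by rw [s1]; exact hz)
      rw [s1, c1] at h
      convert h using 2
      rw [hj]; linear_combination hTd
    have hH := H i d0 hd
    rw [← hj] at hH
    have pre : ∀ k e', fl (g := g) k e' (2*g-1) <+: fl k e' (2*g) := fun k e' =>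
      fl_initial k e' (by omega)
    rcases Lx with Lx | ⟨Lx, hDx⟩
    · exfalso
      rcases Ly with Ly | ⟨Ly, _⟩
      · exact hH.1 ⟨Lx, (pre _ _).trans Ly⟩
      · exact hH.1 ⟨Lx, Ly⟩
    rcases Ly with Ly | ⟨Ly, hDy⟩
    · exact absurd ⟨Lx, Ly⟩ hH.2
    have b1 := bk1 x hPx
    have b2 := bk1 y hPy
    have b3 := bk2 x hPx'
    have b4 := bk2 y hPy'
    rw [← hQx] at b3
    rw [← hQy] at b4
    have hC : S.C (S.Q x i d0 (2*g)) (S.Q y i d0 (2*g)) := by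
      refine S.vac hd hDx hDy ?_ ?_ (Or.inr (by rw [hj]; linear_combination -TT))
      · rwa [show j - d0 + S.T + d0 = i - d0 by rw [hj]; linear_combination TT]
      · rwa [show i + d0 + S.T - d0 = i + S.T by ring]
    have h9 := S.C_add hC
    rw [Q_Q] at h9
    have h10 := S.ln_Q hPx
    have h11 := S.ln_Q hPy
    omega
  · have hx2g : ¬ S.P x i d (2*g) := by
      intro h
      apply hjx
      rw [hj]; exact S.D_other hd h
    obtain ⟨m, hm1, hm2, hm3⟩ := S.exists_max _ _ _ hx2g
    by_cases hm : m + 2 ≤ 2*g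
    · have := S.lemLL hd hPy hm2 hm3 hm (by rw [← hj]; exact hjx)
      omega
    obtain rfl : m = 2*g-1 := by omega
    have hPy1 : S.P y i d (2*g-1) := S.P_mono hPy (by omega)
    have hlnx := S.ln_Q hm2
    have hlny := S.ln_Q hPy1
    have hlast : i + ((2*g-1 : ℕ) : ZMod (4*g)) * d = j := by
      rw [c1, hj]; linear_combination hTd
    have hjx'' : ¬ S.D (S.Q x i d (2*g-1)) j := by
      intro h
      apply hm3
      rw [P_add, P_one, hlast]
      exact ⟨hm2, h⟩
    have hjy3 : S.D (S.Q y i d (2*g-1)) j := by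
      have h : S.P y i d (2*g-1+1) := by rw [s1]; exact hPy
      rw [P_add, P_one, hlast] at h
      exact h.2
    have hy'' : S.Q y i d (2*g) = (S.e j)⁻¹ * S.Q y i d (2*g-1) := by
      rw [← s1, Q_last, hlast, s1]
    have bk : ∀ z, S.P z i d (2*g-1) → ¬ S.D (S.Q z i d (2*g-1)) (j + S.T - d) := by
      intro z hz
      have h := S.not_back_Q (m := 2*g-2) (by rw [s2']; exact hz)
      rw [s2', c2] at h
      convert h using 2
      rw [hj]; linear_combination -hTd
    have bx := bk x hm2
    have bz := bk y hPy1
    suffices hC : S.C (S.Q x i d (2*g-1)) (S.Q y i d (2*g-1)) by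
      have h9 := S.C_add hC
      rw [Q_Q] at h9
      omega
    have Lx : fl i d (2*g-1) <+: (i :: ks) ∨ S.D (S.Q x i d (2*g-1)) (j - 2*d) := by
      have h := S.lemL1 (M := 2*g-3) hd hx (by rw [s3]; exact hm2)
      rw [s3, c3] at h
      refine h.imp id fun h => ?_
      convert h.2 using 1
      rw [hj]; linear_combination -hTd
    rcases Lx with Lx | Lx
    · have hDy : S.D (S.Q y i d (2*g)) (i + d) := by
        rcases Ly with Ly | Ly
        · exfalso
          have hH := (H i d hd).2
          rw [← hj] at hH
          exact hH ⟨Lx, Ly⟩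
        · exact Ly.2
      have hno : ¬ S.D (S.Q y i d (2*g)) (j - d) := by
        intro h
        have := S.near hDy h
        rcases hd with rfl | rfl <;> rcases this with h | h | h
        · exact n6 (by linear_combination (-2) * (h - hj) + TT)
        · exact n2 (by linear_combination -(h - hj))
        · exact n4 (by linear_combination -(h - hj))
        · exact n6 (by linear_combination 2 * (h - hj) - TT)
        · exact n4 (by linear_combination (h - hj))
        · exact n2 (by linear_combination (h - hj))
      rw [hy''] at hno
      have hDy3 : ∀ k, S.D (S.Q y i d (2*g-1)) k → k = j := by
        intro k hk
        by_contra hkj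
        obtain ⟨d1, hd1, h1, h2⟩ := S.two hjy3 hk (Ne.symm hkj)
        have : d1 = -d := by
          have : d1 ≠ d := by rintro rfl; rw [h1] at hk; exact bz hk
          exact pm_neg hd hd1 this
        subst this
        have h3 := S.D_second (by omega : 2 ≤ 2*g) h2
        exact hno (by simpa [sub_eq_add_neg] using h3)
      constructor
      · intro k hk1 hk2
        rw [hDy3 k hk2] at hk1
        exact hjx'' hk1
      · intro a d1 m n hd1 hm hn h1 h2
        have h3 := hDy3 _ (S.D_of_P hn h2)
        rw [h3] at h2
        have hD1 : d1 = d := by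
          by_contra hne
          have : d1 = -d := pm_neg hd hd1 hne
          subst this
          apply bx
          convert S.D_of_P hm h1 using 1
          linear_combination -h3 + TT
        subst hD1
        have hn1 : n = 1 := by
          by_contra hn1
          have h4 := S.D_second (by omega : 2 ≤ n) h2
          exact hno (by simpa [sub_eq_add_neg] using h4)
        by_contra hlt
        apply hjx''
        rw [← h3]
        exact S.D_other hd (S.P_mono h1 (by omega))
    · refine S.vac hd Lx hjy3 ?_ bz (Or.inl (by ring))
      rwa [show j - 2*d + S.T + d = j + S.T - d by ring]

theorem main_abstract {x y : G} {i j ks ls} (hij : i ≠ j) (hx : S.Geo (i :: ks) x)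
    (hy : S.Geo (j :: ls) y) (H : S.Hyp (i :: ks) (j :: ls)) :
    S.ln x + S.ln y ≤ S.ln (x⁻¹ * y) + 4*g := by
  by_cases hiy : S.D y i
  · exact S.caseA1 hij hx hy H hiy
  by_cases hjx : S.D x j
  · have h := S.caseA1 hij.symm hy hx (S.Hyp_symm H) hjx
    rw [← S.ln_inv (y⁻¹ * x), mul_inv_rev, inv_inv] at h
    omega
  by_cases hk : ∃ k, S.D x k ∧ S.D y k
  · obtain ⟨k, hkx, hky⟩ := hk
    exact S.caseA3 hij (S.Geo_cons hx).1 (S.Geo_cons hy).1 hiy hjx hkx hky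
  · exact S.caseB fun k h1 h2 => hk ⟨k, h1, h2⟩

end GSys

end Abstract3

end SG
namespace SG

section States

/-- the half-turn in `ZMod (4g)` -/
def Tg (g : ℕ) : ZMod (4*g) := ((2*g : ℕ) : ZMod (4*g))

theorem Tg_add (g : ℕ) : Tg g + Tg g = 0 := by
  unfold Tg
  rw [← Nat.cast_add, show 2*g + 2*g = 4*g by ring]
  exact ZMod.natCast_self _

/-- a local frame: an orientation and a rotation -/
@[ext] structure St (g : ℕ) where
  ε : ZMod (4*g)
  t : ZMod (4*g)
  h : ε = 1 ∨ ε = -1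

variable {g : ℕ}

theorem St.sq (σ : St g) : σ.ε * σ.ε = 1 := by
  rcases σ.h with h | h <;> simp [h]

theorem St.mulT (σ : St g) : σ.ε * Tg g = Tg g := by
  rcases σ.h with h | h
  · simp [h]
  · rw [h]; linear_combination - Tg_add g

/-- label of the edge leaving a frame along a letter -/
def lab (σ : St g) (k : ZMod (4*g)) : ZMod (4*g) := σ.ε * k + σ.t

/-- letter of the edge leaving a frame with a label -/
def letr (σ : St g) (i : ZMod (4*g)) : ZMod (4*g) := σ.ε * (i - σ.t)

/-- frame after crossing the edge with label `i` -/
def nxt (σ : St g) (i : ZMod (4*g)) : St g where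
  ε := - σ.ε
  t := 2 * i + Tg g - σ.t
  h := by rcases σ.h with h | h <;> simp [h]

theorem lab_letr (σ : St g) (i) : lab σ (letr σ i) = i := by
  unfold lab letr
  linear_combination (i - σ.t) * σ.sq

theorem letr_lab (σ : St g) (k) : letr σ (lab σ k) = k := by
  unfold lab letr
  linear_combination k * σ.sq

theorem nxt_nxt (σ : St g) (i) : nxt (nxt σ i) i = σ := by
  ext
  · simp [nxt]
  · simp [nxt]

theorem lab_nxt_inv (σ : St g) (k) : lab (nxt σ (lab σ k)) (k + Tg g) = lab σ k := by
  have := σ.mulT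
  unfold lab nxt
  dsimp
  linear_combination - this

theorem letr_nxt (σ : St g) (i) : letr (nxt σ i) i = letr σ i + Tg g := by
  have := σ.mulT
  have := Tg_add g
  unfold letr nxt
  dsimp
  linear_combination (σ.mulT)

theorem lab_nxt_add (σ : St g) (k d) :
    lab (nxt σ (lab σ k)) (k + d) = lab σ k + Tg g - σ.ε * d := by
  unfold lab nxt
  dsimp
  ring

def labs : St g → List (ZMod (4*g)) → List (ZMod (4*g))
  | _, [] => []
  | σ, k :: ks => lab σ k :: labs (nxt σ (lab σ k)) ks

def lets : St g → List (ZMod (4*g)) → List (ZMod (4*g))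
  | _, [] => []
  | σ, i :: ls => letr σ i :: lets (nxt σ i) ls

theorem labs_lets (σ : St g) (ls) : labs σ (lets σ ls) = ls := by
  induction ls generalizing σ with
  | nil => rfl
  | cons i ls ih => simp [labs, lets, lab_letr, ih]

theorem lets_labs (σ : St g) (ks) : lets σ (labs σ ks) = ks := by
  induction ks generalizing σ with
  | nil => rfl
  | cons i ls ih => simp [labs, lets, letr_lab, ih]

theorem length_labs (σ : St g) (ks) : (labs σ ks).length = ks.length := by
  induction ks generalizing σ with
  | nil => rfl
  | cons i ls ih => simp [labs, ih]

theorem length_lets (σ : St g) (ks) : (lets σ ks).length = ks.length := by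
  induction ks generalizing σ with
  | nil => rfl
  | cons i ls ih => simp [lets, ih]

/-- final frame -/
def fin (σ : St g) (ls : List (ZMod (4*g))) : St g := ls.foldl nxt σ

theorem labs_append (σ : St g) (ks ks') :
    labs σ (ks ++ ks') = labs σ ks ++ labs (fin σ (labs σ ks)) ks' := by
  induction ks generalizing σ with
  | nil => rfl
  | cons k ks ih => simp [labs, ih, fin]

theorem lets_append (σ : St g) (ks ks') :
    lets σ (ks ++ ks') = lets σ ks ++ lets (fin σ ks) ks' := by
  induction ks generalizing σ with
  | nil => rfl
  | cons k ks ih => simp [lets, ih, fin]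

theorem labs_fl (σ : St g) (k d) (m : ℕ) :
    labs σ (fl k d m) = alt (lab σ k) (lab σ k + Tg g - σ.ε * d) m := by
  induction m generalizing σ k with
  | zero => rfl
  | succ m ih =>
    simp only [fl, labs, alt, ih, lab_nxt_add]
    congr 2
    unfold nxt
    dsimp
    linear_combination Tg_add g

theorem fin_alt (σ : St g) (i j) (m : ℕ) :
    fin σ (alt i j (2*m)) = ⟨σ.ε, σ.t + m * (2*j - 2*i), σ.h⟩ := by
  induction m generalizing σ with
  | zero => ext <;> simp [alt, fin]
  | succ m ih =>
    rw [show 2 * (m + 1) = 2 * m + 1 + 1 by ring]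
    have : fin σ (alt i j (2*m+1+1)) = fin (nxt (nxt σ i) j) (alt i j (2*m)) := by
      simp [alt, fin]
    rw [this, ih]
    ext
    · simp [nxt]
    · simp only [nxt]; push_cast; ring

theorem fin_alt_full (σ : St g) (i j) : fin σ (alt i j (2*(2*g))) = σ := by
  rw [fin_alt]
  ext
  · rfl
  · have h : ((2*g : ℕ) : ZMod (4*g)) = Tg g := rfl
    dsimp only
    rw [h]
    linear_combination (j - i) * Tg_add g

theorem fl_of_alt (σ : St g) (i j δ) (hj : j = i + Tg g + δ) (m : ℕ) :
    lets σ (alt i j m) = fl (letr σ i) (-(σ.ε * δ)) m := by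
  have := labs_fl σ (letr σ i) (-(σ.ε * δ)) m
  rw [lab_letr] at this
  rw [← lets_labs σ (fl _ _ _), this, hj]
  congr 2
  linear_combination -δ * σ.sq

end States

section CoxM

variable {g : ℕ}

theorem Tg_pm (hg : 2 ≤ g) : Tg g + 1 ≠ 0 ∧ Tg g - 1 ≠ 0 := by
  have h1 : ((2*g+1 : ℕ) : ZMod (4*g)) ≠ 0 := by
    intro h
    have := Nat.le_of_dvd (by omega) ((ZMod.natCast_eq_zero_iff _ _).1 h)
    omega
  have h2 : ((2*g-1 : ℕ) : ZMod (4*g)) ≠ 0 := by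
    intro h
    have := Nat.le_of_dvd (by omega) ((ZMod.natCast_eq_zero_iff _ _).1 h)
    omega
  constructor
  · unfold Tg; exact_mod_cast h1
  · unfold Tg; rw [Nat.cast_sub (by omega)] at h2; exact_mod_cast h2

/-- adjacency of labels -/
def Adj (i j : ZMod (4*g)) : Prop := j = i + Tg g + 1 ∨ j = i + Tg g - 1

theorem Adj.symm {i j : ZMod (4*g)} (h : Adj i j) : Adj j i := by
  have := Tg_add g
  rcases h with rfl | rfl
  · right; linear_combination -this
  · left; linear_combination -this

open Classical in
/-- the Coxeter matrix of the reflection group of the tessellation -/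
noncomputable def CM (hg : 2 ≤ g) : CoxeterMatrix (ZMod (4*g)) where
  M := Matrix.of fun i j => if i = j then 1 else if Adj i j then 2*g else 0
  isSymm := by
    ext i j
    simp only [Matrix.transpose_apply, Matrix.of_apply]
    have h : Adj i j ↔ Adj j i := ⟨Adj.symm, Adj.symm⟩
    simp only [h, eq_comm]
  diagonal := by simp
  off_diagonal := by
    intro i j hij
    simp only [Matrix.of_apply, if_neg hij]
    split_ifs <;> omega

open Classical in
theorem CM_apply (hg : 2 ≤ g) (i j) :
    CM hg i j = if i = j then 1 else if Adj i j then 2*g else 0 := rfl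

theorem CM_even (hg : 2 ≤ g) (i j) (hij : i ≠ j) : Even (CM hg i j) := by
  rw [CM_apply, if_neg hij]
  split_ifs <;> simp

noncomputable abbrev CS (hg : 2 ≤ g) := (CM hg).toCoxeterSystem

theorem Adj.ne (hg : 2 ≤ g) {i j : ZMod (4*g)} (h : Adj i j) : i ≠ j := by
  rintro rfl
  rcases h with h | h
  · exact (Tg_pm hg).1 (by linear_combination -h)
  · exact (Tg_pm hg).2 (by linear_combination -h)

theorem wordProd_full (hg : 2 ≤ g) {i j} (h : Adj i j) :
    (CS hg).wordProd (alt i j (2*(2*g))) = 1 := by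
  rw [wordProd_alt_even]
  have := (CS hg).simple_mul_simple_pow i j
  rw [CM_apply, if_neg (h.ne hg), if_pos h] at this
  exact this

end CoxM

end SG
namespace SG

section Letters

variable {g : ℕ}

/-- position of a letter on the cyclic word `R` -/
def pos (g : ℕ) (a : Letter g) : ZMod (4*g) := if a.2 then ((a.1 : ℕ) : ZMod (4*g))
  else ((a.1 : ℕ) : ZMod (4*g)) + Tg g

theorem pos_bij (hg : 2 ≤ g) : Function.Bijective (pos g) := by
  haveI : NeZero (4*g) := ⟨by omega⟩
  have hcard : Fintype.card (Letter g) = Fintype.card (ZMod (4*g)) := by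
    rw [ZMod.card]; simp; ring
  rw [Fintype.bijective_iff_injective_and_card]
  refine ⟨?_, hcard⟩
  have key : ∀ a : Letter g, (pos g a).val = a.1 + (if a.2 then 0 else 2*g) := by
    rintro ⟨i, b⟩
    have := i.2
    cases b
    · simp only [pos, Tg, Bool.false_eq_true, if_false]
      rw [← Nat.cast_add, ZMod.val_natCast_of_lt (by omega)]
    · simp only [pos, if_true]
      rw [ZMod.val_natCast_of_lt (by omega)]; rfl
  rintro ⟨i, b⟩ ⟨j, c⟩ h
  have h1 := congrArg ZMod.val h
  rw [key, key] at h1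
  have := i.2
  have := j.2
  ext
  · cases b <;> cases c <;> simp at h1 ⊢ <;> omega
  · cases b <;> cases c <;> simp at h1 ⊢ <;> omega

theorem pos_inv (a : Letter g) : pos g (invLetter g a) = pos g a + Tg g := by
  obtain ⟨i, b⟩ := a
  cases b
  · simp [pos, invLetter, add_assoc, Tg_add]
  · simp [pos, invLetter]

theorem fl_ofFn (k d : ZMod (4*g)) (m : ℕ) :
    fl k d m = List.ofFn fun i : Fin m => k + ((i : ℕ) : ZMod (4*g)) * d := by
  induction m generalizing k with
  | zero => rfl
  | succ m ih =>
    rw [List.ofFn_succ]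
    simp only [fl, ih]
    congr 1
    · simp
    · congr 1; ext i; simp; ring

theorem Rword_pos (g : ℕ) : (Rword g).map (pos g) = fl 0 1 (4*g) := by
  rw [show (fl 0 1 (4*g) : List (ZMod (4*g))) = fl 0 1 (2*g + 2*g) by congr 1; ring, fl_add,
    fl_ofFn, fl_ofFn]
  unfold Rword
  rw [List.map_append, List.map_ofFn, List.map_ofFn]
  congr 2
  · ext i; simp [pos]
  · ext i; simp [pos, Tg]; ring

noncomputable def θ (hg : 2 ≤ g) : Letter g ≃ ZMod (4*g) := Equiv.ofBijective _ (pos_bij hg)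

theorem θ_apply (hg : 2 ≤ g) (a) : θ hg a = pos g a := rfl

/-- element of the surface group for a position -/
noncomputable def ee (hg : 2 ≤ g) (k : ZMod (4*g)) : SurfaceGroup g :=
  evalLetter g ((θ hg).symm k)

theorem ee_pos (hg : 2 ≤ g) (a) : ee hg (pos g a) = evalLetter g a := by
  unfold ee; rw [← θ_apply hg, Equiv.symm_apply_apply]

theorem evalLetter_inv (a : Letter g) : evalLetter g (invLetter g a) = (evalLetter g a)⁻¹ := by
  obtain ⟨i, b⟩ := a
  cases b <;> simp [evalLetter, invLetter]

theorem ee_inv (hg : 2 ≤ g) (k) : ee hg (k + Tg g) = (ee hg k)⁻¹ := by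
  obtain ⟨a, rfl⟩ := (pos_bij hg).2 k
  rw [← pos_inv, ee_pos, ee_pos, evalLetter_inv]

/-- a generic map on letters -/
theorem gen_map {H : Type*} [Group H] (eH : ZMod (4*g) → H)
    (hinv : ∀ k, eH (k + Tg g) = (eH k)⁻¹) :
    FreeGroup.lift (fun i : Fin (2*g) => eH (((i : ℕ) : ZMod (4*g)))) (relator g) =
      ((fl 0 1 (4*g)).map eH).prod := by
  rw [← Rword_pos]
  unfold relator Rword
  simp only [map_mul, map_list_prod, List.map_append, List.prod_append, List.map_map, List.map_ofFn]
  congr 3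
  · ext i; simp [pos]
  · ext i; simp [pos, hinv]

theorem ee_rel (hg : 2 ≤ g) : ((fl 0 1 (4*g)).map (ee hg)).prod = 1 := by
  rw [← gen_map (ee hg) (ee_inv hg)]
  have : FreeGroup.lift (fun i : Fin (2*g) => ee hg (((i : ℕ) : ZMod (4*g)))) =
      PresentedGroup.mk {relator g} := by
    ext i
    have : ((i : ℕ) : ZMod (4*g)) = pos g (i, true) := by simp [pos]
    simp only [FreeGroup.lift_apply_of, this, ee_pos]
    simp [evalLetter, gen, PresentedGroup.of]
  rw [this]
  exact PresentedGroup.one_of_mem (by simp)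

theorem exists_hom (hg : 2 ≤ g) {H : Type*} [Group H] (eH : ZMod (4*g) → H)
    (hinv : ∀ k, eH (k + Tg g) = (eH k)⁻¹) (hrel : ((fl 0 1 (4*g)).map eH).prod = 1) :
    ∃ φ : SurfaceGroup g →* H, ∀ k, φ (ee hg k) = eH k := by
  refine ⟨PresentedGroup.toGroup (f := fun i : Fin (2*g) => eH (((i : ℕ) : ZMod (4*g)))) ?_, ?_⟩
  · intro r hr
    rw [Set.mem_singleton_iff.1 hr, gen_map eH hinv, hrel]
  · intro k
    obtain ⟨⟨i, b⟩, rfl⟩ := (pos_bij hg).2 k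
    rw [ee_pos]
    cases b
    · simp [evalLetter, pos, gen, hinv]
    · simp [evalLetter, pos, gen]

/-- product of an arithmetic run of letters -/
noncomputable def pr (hg : 2 ≤ g) (k d : ZMod (4*g)) (m : ℕ) : SurfaceGroup g :=
  ((fl k d m).map (ee hg)).prod

theorem pr_succ (hg : 2 ≤ g) (k d) (m : ℕ) : pr hg k d (m+1) = ee hg k * pr hg (k + d) d m := by
  simp [pr, fl]

theorem pr_add (hg : 2 ≤ g) (k d) (m n : ℕ) :
    pr hg k d (m+n) = pr hg k d m * pr hg (k + m * d) d n := by
  simp [pr, fl_add]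

theorem pr_full_one (hg : 2 ≤ g) (k) : pr hg k 1 (4*g) = 1 := by
  haveI : NeZero (4*g) := ⟨by omega⟩
  have h : ∀ n : ℕ, pr hg n 1 (4*g) = 1 := by
    intro n
    induction n with
    | zero => simpa [pr] using ee_rel hg
    | succ n ih =>
      obtain ⟨m, hm⟩ : ∃ m, 4*g = m + 1 := ⟨4*g-1, by omega⟩
      have hc : ((m : ZMod (4*g)) + 1) = 0 := by
        have := ZMod.natCast_self (4*g)
        rw [← Nat.cast_succ, Nat.succ_eq_add_one, ← hm]; exact this
      have h1 : pr hg (n+1 : ℕ) 1 (4*g) = pr hg ((n:ZMod (4*g))+1) 1 m * ee hg n := by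
        rw [show pr hg (n+1 : ℕ) 1 (4*g) = pr hg (n+1 : ℕ) 1 (m+1) by congr 1, pr_add]
        rw [pr_succ]
        have : ((n+1 : ℕ) : ZMod (4*g)) + m * 1 = n := by
          push_cast; linear_combination hc
        rw [this]; simp [pr, fl]
      have h2 : pr hg n 1 (4*g) = ee hg n * pr hg ((n:ZMod (4*g))+1) 1 m := by
        rw [show pr hg n 1 (4*g) = pr hg n 1 (m+1) by congr 1, pr_succ]
      rw [h2] at ih
      rw [h1]
      exact mul_eq_one_comm.1 ih
  have := h k.val
  rwa [ZMod.natCast_zmod_val] at this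

theorem pr_inv (hg : 2 ≤ g) (k d) (m : ℕ) :
    (pr hg k d m)⁻¹ = pr hg (k + (m - 1) * d + Tg g) (-d) m := by
  induction m generalizing k with
  | zero => simp [pr, fl]
  | succ m ih =>
    rw [pr_succ, mul_inv_rev, ih, pr_add]
    congr 1
    · congr 1; push_cast; ring
    · rw [pr_succ, ← ee_inv]
      simp only [pr, fl, List.map_nil, List.prod_nil, mul_one]
      congr 1; push_cast; ring

theorem pr_full (hg : 2 ≤ g) (k d) (hd : d = 1 ∨ d = -1) : pr hg k d (4*g) = 1 := by
  rcases hd with rfl | rfl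
  · exact pr_full_one hg k
  · have := pr_inv hg k (-1) (4*g)
    rw [neg_neg, pr_full_one] at this
    exact inv_eq_one.1 this

theorem pr_half (hg : 2 ≤ g) (k d) (hd : d = 1 ∨ d = -1) :
    pr hg k d (2*g) = pr hg (k + Tg g - d) (-d) (2*g) := by
  have h1 := pr_full hg k d hd
  rw [show pr hg k d (4*g) = pr hg k d (2*g+2*g) by congr 1; ring, pr_add] at h1
  rw [eq_inv_of_mul_eq_one_left h1, pr_inv]
  congr 1
  have h : ((2*g : ℕ) : ZMod (4*g)) = Tg g := rfl
  rw [h]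
  have := Tg_add g
  rcases hd with rfl | rfl
  · linear_combination this
  · linear_combination -this

theorem Quo_eq (hg : 2 ≤ g) (y k d) (m : ℕ) : Quo (ee hg) y k d m = (pr hg k d m)⁻¹ * y := by
  induction m generalizing y k with
  | zero => simp [Quo, pr, fl]
  | succ m ih => simp [Quo, ih, pr_succ, mul_assoc]

end Letters

section Homs

variable {g : ℕ} {X : Type*}

open MulOpposite in
theorem op_foldl {I : Type*} (p : I → Equiv.Perm X) (ks : List I) (x : X) :
    ((ks.map fun k => op (p k)).prod).unop x = ks.foldl (fun x k => p k x) x := by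
  induction ks generalizing x with
  | nil => rfl
  | cons k ks ih => simp [ih]

/-- letters acting on framed chambers -/
noncomputable def pe (hg : 2 ≤ g) (k : ZMod (4*g)) :
    Equiv.Perm ((CM hg).Group × St g) where
  toFun x := (x.1 * (CS hg).simple (lab x.2 k), nxt x.2 (lab x.2 k))
  invFun x := (x.1 * (CS hg).simple (lab x.2 (k + Tg g)), nxt x.2 (lab x.2 (k + Tg g)))
  left_inv x := by
    simp only [lab_nxt_inv, nxt_nxt, CoxeterSystem.simple_mul_simple_cancel_right]
  right_inv x := by
    have h : ∀ σ : St g, lab (nxt σ (lab σ (k + Tg g))) k = lab σ (k + Tg g) := by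
      intro σ
      have := lab_nxt_inv σ (k + Tg g)
      rwa [add_assoc, Tg_add, add_zero] at this
    simp only [h, nxt_nxt, CoxeterSystem.simple_mul_simple_cancel_right]

theorem pe_foldl (hg : 2 ≤ g) (ks) (w : (CM hg).Group) (σ : St g) :
    ks.foldl (fun x k => pe hg k x) (w, σ) =
      (w * (CS hg).wordProd (labs σ ks), fin σ (labs σ ks)) := by
  induction ks generalizing w σ with
  | nil => simp [labs, fin]
  | cons k ks ih =>
    simp only [List.foldl_cons]
    rw [show pe hg k (w, σ) = (w * (CS hg).simple (lab σ k), nxt σ (lab σ k)) from rfl, ih]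
    simp [labs, fin, CoxeterSystem.wordProd_cons, mul_assoc]

open MulOpposite in
theorem labs_congr (hg : 2 ≤ g) (σ : St g) {ks ks'}
    (h : (ks.map (ee hg)).prod = (ks'.map (ee hg)).prod) :
    (CS hg).wordProd (labs σ ks) = (CS hg).wordProd (labs σ ks') ∧
      fin σ (labs σ ks) = fin σ (labs σ ks') := by
  obtain ⟨φ, hφ⟩ := exists_hom hg (fun k => op (pe hg k)) (by
    intro k
    rw [← op_inv]
    congr 1
    rw [eq_inv_iff_mul_eq_one]
    ext1 x
    exact (pe hg k).left_inv x) (by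
    apply unop_injective
    ext1 x
    have h4 : ∀ i j : ZMod (4*g), alt i j (4*g) = alt i j (2*(2*g)) := by
      intro i j; congr 1; ring
    rw [op_foldl, pe_foldl, labs_fl, h4, fin_alt_full, wordProd_full]
    · simp
    · rcases x.2.h with h | h <;> rw [h]
      · right; ring
      · left; ring)
  have key : ∀ ks : List (ZMod (4*g)), (φ (ks.map (ee hg)).prod).unop (1, σ) =
      ((CS hg).wordProd (labs σ ks), fin σ (labs σ ks)) := by
    intro ks
    have := pe_foldl hg ks 1 σ
    rw [one_mul] at this
    rw [← this, ← op_foldl, map_list_prod, List.map_map]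
    simp [Function.comp_def, hφ]
  have h1 := key ks
  rw [h, key ks'] at h1
  exact ⟨(congrArg Prod.fst h1).symm, (congrArg Prod.snd h1).symm⟩

/-- labels acting on framed vertices -/
noncomputable def qe (hg : 2 ≤ g) (i : ZMod (4*g)) :
    Equiv.Perm (SurfaceGroup g × St g) :=
  Function.Involutive.toPerm (fun x => (x.1 * ee hg (letr x.2 i), nxt x.2 i)) (by
    intro x
    simp only [letr_nxt, nxt_nxt, ee_inv, mul_inv_cancel_right])

theorem qe_foldl (hg : 2 ≤ g) (ls) (u : SurfaceGroup g) (σ : St g) :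
    ls.foldl (fun x k => qe hg k x) (u, σ) =
      (u * ((lets σ ls).map (ee hg)).prod, fin σ ls) := by
  induction ls generalizing u σ with
  | nil => simp [lets, fin]
  | cons k ks ih =>
    simp only [List.foldl_cons]
    rw [show qe hg k (u, σ) = (u * ee hg (letr σ k), nxt σ k) from rfl, ih]
    simp [lets, fin, mul_assoc]

theorem alt_prod {H I : Type*} [Monoid H] (f : I → H) (i j : I) (m : ℕ) :
    (f i * f j) ^ m = ((alt i j (2*m)).map f).prod := by
  induction m with
  | zero => simp [alt]
  | succ m ih =>
    rw [show 2 * (m + 1) = 2 * m + 1 + 1 by ring, pow_succ']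
    simp [alt, ih, mul_assoc]

open MulOpposite in
theorem lets_congr (hg : 2 ≤ g) (σ : St g) {ls ls'}
    (h : (CS hg).wordProd ls = (CS hg).wordProd ls') :
    ((lets σ ls).map (ee hg)).prod = ((lets σ ls').map (ee hg)).prod := by
  classical
  have hl : (CM hg).IsLiftable (fun k => op (qe hg k)) := by
    intro i j
    have hsq : ∀ i, (fun k => op (qe hg k)) i * (fun k => op (qe hg k)) i = 1 := by
      intro i
      apply unop_injective
      ext1 x
      exact (qe hg i).left_inv x
    rw [CM_apply]
    split_ifs with h1 h2
    · subst h1; rw [pow_one]; exact hsq i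
    · rw [alt_prod (fun k => op (qe hg k))]
      apply unop_injective
      ext1 x
      rw [op_foldl, qe_foldl, fin_alt_full]
      have : ((lets x.2 (alt i j (2*(2*g)))).map (ee hg)).prod = 1 := by
        have hd : ∀ δ : ZMod (4*g), (δ = 1 ∨ δ = -1) → -(x.2.ε * δ) = 1 ∨ -(x.2.ε * δ) = -1 := by
          rintro δ (rfl | rfl) <;> rcases x.2.h with h | h <;> simp [h]
        have h4 : ∀ k d : ZMod (4*g), fl k d (2*(2*g)) = fl k d (4*g) := by
          intro i j; congr 1; ring
        rcases h2 with h2 | h2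
        · rw [fl_of_alt x.2 i j 1 h2, h4]
          exact pr_full hg _ _ (hd _ (Or.inl rfl))
        · rw [fl_of_alt x.2 i j (-1) (by rw [h2]; ring), h4]
          exact pr_full hg _ _ (hd _ (Or.inr rfl))
      rw [this]; simp
    · simp
  have key : ∀ ls : List (ZMod (4*g)),
      (((CS hg).lift ⟨_, hl⟩) ((CS hg).wordProd ls)).unop (1, σ) =
      (((lets σ ls).map (ee hg)).prod, fin σ ls) := by
    intro ls
    have := qe_foldl hg ls 1 σ
    rw [one_mul] at this
    rw [← this, ← op_foldl, CoxeterSystem.wordProd, map_list_prod, List.map_map]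
    congr 3
  have h1 := key ls
  rw [h, key ls'] at h1
  exact (congrArg Prod.fst h1).symm

end Homs

end SG
namespace SG

section Instance

variable {g : ℕ}

theorem eval_eq (hg : 2 ≤ g) (W : Word g) : eval g W = ((W.map (pos g)).map (ee hg)).prod := by
  unfold eval
  rw [List.map_map]
  congr 2
  ext1 a
  exact (ee_pos hg a).symm

theorem prod_eq (hg : 2 ≤ g) (ks : List (ZMod (4*g))) :
    (ks.map (ee hg)).prod = eval g (ks.map (θ hg).symm) := by
  unfold eval
  rw [List.map_map]
  rfl

theorem exists_word (u : SurfaceGroup g) : ∃ W : Word g, eval g W = u := by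
  induction u using PresentedGroup.induction_on with
  | _ z =>
    induction z using FreeGroup.induction_on with
    | C1 => exact ⟨[], by simp [eval]⟩
    | of i => exact ⟨[(i, true)], by simp [eval, evalLetter, gen, PresentedGroup.of]⟩
    | inv_of i _ => exact ⟨[(i, false)], by simp [eval, evalLetter, gen, PresentedGroup.of]⟩
    | mul x y hx hy =>
      obtain ⟨A, hA⟩ := hx
      obtain ⟨B, hB⟩ := hy
      exact ⟨A ++ B, by rw [map_mul, ← hA, ← hB]; simp [eval]⟩

theorem exists_geo_word (u : SurfaceGroup g) : ∃ W : Word g, W.length = len g u ∧ eval g W = u := by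
  have : (len g u) ∈ {n | ∃ W : Word g, W.length = n ∧ eval g W = u} := by
    apply Nat.sInf_mem
    obtain ⟨W, h⟩ := exists_word u
    exact ⟨_, W, rfl, h⟩
  exact this

theorem len_eval_le (W : Word g) : len g (eval g W) ≤ W.length := Nat.sInf_le ⟨W, rfl, rfl⟩

theorem len_le (hg : 2 ≤ g) (ks : List (ZMod (4*g))) : len g (ks.map (ee hg)).prod ≤ ks.length := by
  rw [prod_eq]
  simpa using len_eval_le (ks.map (θ hg).symm)

theorem exists_geo (hg : 2 ≤ g) (u) : ∃ ks : List (ZMod (4*g)), (ks.map (ee hg)).prod = u ∧ ks.length = len g u := by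
  obtain ⟨W, h1, h2⟩ := exists_geo_word u
  exact ⟨W.map (pos g), by rw [← eval_eq, h2], by simpa using h1⟩

theorem length_labs_eq (hg : 2 ≤ g) (σ : St g) (ks) :
    (CS hg).length ((CS hg).wordProd (labs σ ks)) = len g (ks.map (ee hg)).prod := by
  apply le_antisymm
  · obtain ⟨ks', h1, h2⟩ := exists_geo hg (ks.map (ee hg)).prod
    rw [(labs_congr hg σ h1.symm).1, ← h2, ← length_labs σ]
    exact (CS hg).length_wordProd_le _
  · obtain ⟨ls, h1, h2⟩ := (CS hg).exists_isReduced ((CS hg).wordProd (labs σ ks))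
    have h3 := lets_congr hg σ h2
    rw [lets_labs] at h3
    rw [h3, h2, h1, ← length_lets σ]
    exact len_le hg _

theorem len_step (hg : 2 ≤ g) (k y) :
    len g (ee hg k * y) = len g y + 1 ∨ len g (ee hg k * y) + 1 = len g y := by
  obtain ⟨ks, rfl, -⟩ := exists_geo hg y
  have h1 := length_labs_eq hg ⟨1, 0, Or.inl rfl⟩ (k :: ks)
  simp only [labs, CoxeterSystem.wordProd_cons, List.map_cons, List.prod_cons] at h1
  rw [← h1, ← length_labs_eq hg (nxt ⟨1, 0, Or.inl rfl⟩ (lab ⟨1, 0, Or.inl rfl⟩ k)) ks]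
  exact (CS hg).length_simple_mul _ _

theorem len_one (hg : 2 ≤ g) : len g (1 : SurfaceGroup g) = 0 := by
  have := len_le hg []
  simpa using this

theorem len_inv_le (hg : 2 ≤ g) (y) : len g y⁻¹ ≤ len g y := by
  obtain ⟨ks, rfl, h⟩ := exists_geo hg y
  have h1 := len_le hg (ks.map (· + Tg g)).reverse
  have h2 : (((ks.map (· + Tg g)).reverse).map (ee hg)).prod = ((ks.map (ee hg)).prod)⁻¹ := by
    rw [List.prod_inv_reverse, List.map_reverse, List.map_map, List.map_map]
    congr 3
    ext1 k
    exact ee_inv hg k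
  rw [h2] at h1
  simpa [h] using h1

theorem exists_dsc (hg : 2 ≤ g) (y) (hy : y ≠ 1) : ∃ k, Dsc (ee hg) (len g) y k := by
  obtain ⟨ks, rfl, h⟩ := exists_geo hg y
  cases ks with
  | nil => simp at hy
  | cons k ks =>
    refine ⟨k, ?_⟩
    unfold Dsc
    simp only [List.map_cons, List.prod_cons, List.length_cons, inv_mul_cancel_left] at h ⊢
    have h1 := len_le hg ks
    rcases len_step hg k (ks.map (ee hg)).prod with h2 | h2 <;> omega

theorem lab_zero (k : ZMod (4*g)) : lab (⟨1, 0, Or.inl rfl⟩ : St g) k = k := by simp [lab]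

theorem dsc_left (hg : 2 ≤ g) {ks y} (hy : (ks.map (ee hg)).prod = y) {k}
    (h : Dsc (ee hg) (len g) y k) :
    (CS hg).IsLeftDescent ((CS hg).wordProd (labs ⟨1, 0, Or.inl rfl⟩ ks)) k := by
  obtain ⟨ks', h1, h2⟩ := exists_geo hg ((ee hg k)⁻¹ * y)
  have h3 : (ks.map (ee hg)).prod = ((k :: ks').map (ee hg)).prod := by
    rw [hy]; simp [h1]
  rw [(labs_congr hg _ h3).1]
  unfold CoxeterSystem.IsLeftDescent
  rw [length_labs_eq, ← h3, hy]
  simp only [labs, lab_zero, CoxeterSystem.wordProd_cons,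
    CoxeterSystem.simple_mul_simple_cancel_left]
  rw [length_labs_eq, h1]
  unfold Dsc at h
  omega

theorem two_dsc (hg : 2 ≤ g) (y k k') (hne : k ≠ k') (hk : Dsc (ee hg) (len g) y k)
    (hk' : Dsc (ee hg) (len g) y k') :
    ∃ d, (d = 1 ∨ d = -1) ∧ k' = k + Tg g - d ∧
      len g (Quo (ee hg) y k d (2*g)) + 2*g = len g y := by
  classical
  obtain ⟨ks, hks, -⟩ := exists_geo hg y
  obtain ⟨h1, h2⟩ := two_descents (CS hg) (CM_even hg) hne (dsc_left hg hks hk)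
    (dsc_left hg hks hk')
  rw [CM_apply, if_neg hne] at h1 h2
  split_ifs at h1 h2 with hadj
  · obtain ⟨d, hd, hdk⟩ : ∃ d, (d = 1 ∨ d = -1) ∧ k' = k + Tg g - d := by
      rcases hadj with h | h
      · exact ⟨-1, Or.inr rfl, by rw [h]; ring⟩
      · exact ⟨1, Or.inl rfl, h⟩
    refine ⟨d, hd, hdk, ?_⟩
    obtain ⟨w', hw, hl⟩ := h2
    obtain ⟨ls, hls, rfl⟩ := (CS hg).exists_isReduced w'
    rw [← CoxeterSystem.wordProd_append] at hw
    have h3 := lets_congr hg ⟨1, 0, Or.inl rfl⟩ hw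
    have h5 := labs_fl (⟨1, 0, Or.inl rfl⟩ : St g) k d (2*g)
    rw [lab_zero] at h5
    simp only [one_mul] at h5
    rw [← hdk] at h5
    rw [lets_labs, lets_append, hks, ← h5, lets_labs, List.map_append, List.prod_append] at h3
    have h6 := len_le hg (lets (fin ⟨1, 0, Or.inl rfl⟩ (labs ⟨1, 0, Or.inl rfl⟩ (fl k d (2*g)))) ls)
    set q := ((lets (fin ⟨1, 0, Or.inl rfl⟩ (labs ⟨1, 0, Or.inl rfl⟩ (fl k d (2*g)))) ls).map
      (ee hg)).prod with hq
    have h7 : Quo (ee hg) y k d (2*g) = q := by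
      rw [Quo_eq, h3]; exact inv_mul_cancel_left _ _
    rw [h7]
    rw [length_lets, ← hls] at h6
    rw [length_labs_eq, hks] at hl
    obtain ⟨qs, hqs, hqs'⟩ := exists_geo hg q
    have h8 := len_le hg (fl k d (2*g) ++ qs)
    rw [List.map_append, List.prod_append, hqs, ← h3, List.length_append, length_fl, hqs'] at h8
    omega
  · exact absurd rfl h1

/-- the surface group satisfies the abstract axioms -/
noncomputable def surf (hg : 2 ≤ g) : GSys g (SurfaceGroup g) where
  e := ee hg
  ln := len g
  T := Tg g
  hg := hg
  T_def := rfl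
  e_inv := ee_inv hg
  ln_one := len_one hg
  ln_inv y := le_antisymm (len_inv_le hg y) (by simpa using len_inv_le hg y⁻¹)
  step := len_step hg
  exists_desc := exists_dsc hg
  swap y k d hd := by rw [Quo_eq, Quo_eq, pr_half hg k d hd]
  two' := two_dsc hg

end Instance

end SG
namespace SG

section Final

variable {g : ℕ}

theorem fl_map_add (k d c : ZMod (4*g)) (m : ℕ) : (fl k d m).map (· + c) = fl (k + c) d m := by
  induction m generalizing k with
  | zero => rfl
  | succ m ih =>
    simp only [fl, List.map_cons, ih]
    congr 2; ring

theorem fl_reverse (k d : ZMod (4*g)) (m : ℕ) :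
    (fl k d m).reverse = fl (k + ((m : ZMod (4*g)) - 1) * d) (-d) m := by
  induction m generalizing k with
  | zero => rfl
  | succ m ih =>
    rw [fl_add _ _ m 1]
    rw [List.reverse_append, ih]
    simp only [fl, List.reverse_cons, List.reverse_nil, List.nil_append, List.cons_append]
    congr 1
    · push_cast; ring
    · congr 1; push_cast; ring

theorem fl_rotate (hg : 2 ≤ g) (k d : ZMod (4*g)) (n : ℕ) :
    (fl k d (4*g)).rotate n = fl (k + (n : ZMod (4*g)) * d) d (4*g) := by
  induction n generalizing k with
  | zero => simp
  | succ n ih =>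
    rw [← List.rotate_rotate, ih]
    obtain ⟨m, hm⟩ : ∃ m, 4*g = m + 1 := ⟨4*g-1, by omega⟩
    have hc : ((m : ZMod (4*g)) + 1) = 0 := by
      have := ZMod.natCast_self (4*g)
      rw [← Nat.cast_succ, Nat.succ_eq_add_one, ← hm]; exact this
    have h4 : ∀ k d : ZMod (4*g), fl k d (4*g) = fl k d (m+1) := by
      intro i j; congr 1
    rw [h4, h4 (k + _), fl_add (k + ((n + 1 : ℕ) : ZMod (4*g)) * d) _ m 1]
    simp only [fl, List.rotate_cons_succ, List.rotate_zero]
    congr 1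
    · congr 1; push_cast; ring
    · congr 1; push_cast; linear_combination -d * hc

theorem wordInv_pos (W : Word g) :
    (wordInv g W).map (pos g) = ((W.map (pos g)).map (· + Tg g)).reverse := by
  unfold wordInv
  rw [List.map_reverse, List.map_map, List.map_map]
  congr 2
  ext1 a
  exact pos_inv a

theorem mem_RSet (hg : 2 ≤ g) (W : Word g) :
    W ∈ RSet g ↔ ∃ k d, (d = 1 ∨ d = -1) ∧ W.map (pos g) = fl k d (4*g) := by
  have : NeZero (4*g) := ⟨by omega⟩
  have hinj : Function.Injective (List.map (pos g)) := List.map_injective_iff.2 (pos_bij hg).1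
  have hR := Rword_pos g
  obtain ⟨c, hI⟩ : ∃ c, (wordInv g (Rword g)).map (pos g) = fl c (-1) (4*g) := by
    rw [wordInv_pos, hR, fl_map_add, fl_reverse]
    exact ⟨_, rfl⟩
  constructor
  · rintro (⟨n, rfl⟩ | ⟨n, rfl⟩)
    · exact ⟨_, 1, Or.inl rfl, by rw [List.map_rotate, hR, fl_rotate hg]⟩
    · exact ⟨_, -1, Or.inr rfl, by rw [List.map_rotate, hI, fl_rotate hg]⟩
  · rintro ⟨k, d, rfl | rfl, h⟩
    · left
      refine ⟨k.val, hinj ?_⟩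
      rw [List.map_rotate, hR, fl_rotate hg, h, ZMod.natCast_zmod_val]
      congr 1; ring
    · right
      refine ⟨(c - k).val, hinj ?_⟩
      rw [List.map_rotate, hI, fl_rotate hg, h, ZMod.natCast_zmod_val]
      congr 1; ring

theorem fl_take (k d : ZMod (4*g)) {m n : ℕ} (h : m ≤ n) : (fl k d n).take m = fl k d m := by
  have := List.prefix_iff_eq_take.1 (fl_initial k d h)
  rw [length_fl] at this
  exact this.symm

theorem map_symm_pos (hg : 2 ≤ g) (ks : List (ZMod (4*g))) :
    (ks.map (θ hg).symm).map (pos g) = ks := by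
  rw [List.map_map]
  have : pos g ∘ (θ hg).symm = id := by
    ext1 k; exact (θ hg).apply_symm_apply k
  rw [this, List.map_id]

theorem isFR_iff (hg : 2 ≤ g) (m : ℕ) (W : Word g) :
    IsFR g m W ↔ 2 ≤ m ∧ m ≤ 4*g ∧ ∃ k d, (d = 1 ∨ d = -1) ∧ W.map (pos g) = fl k d m := by
  have hinj : Function.Injective (List.map (pos g)) := List.map_injective_iff.2 (pos_bij hg).1
  unfold IsFR
  refine and_congr_right fun h2 => and_congr_right fun h4 => ?_
  constructor
  · rintro ⟨B, hB, rfl⟩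
    obtain ⟨k, d, hd, h⟩ := (mem_RSet hg B).1 hB
    exact ⟨k, d, hd, by rw [List.map_take, h, fl_take _ _ h4]⟩
  · rintro ⟨k, d, hd, h⟩
    refine ⟨(fl k d (4*g)).map (θ hg).symm, (mem_RSet hg _).2 ⟨k, d, hd, map_symm_pos hg _⟩,
      hinj ?_⟩
    rw [h, List.map_take, map_symm_pos hg, fl_take _ _ h4]

theorem irr_min {U : Word g} (hU : IrreducibleWord g U) {W : Word g} (h : eval g W = eval g U) :
    U.length ≤ W.length := by
  rcases hU W h with rfl | h | h
  · exact le_rfl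
  · exact h.le
  · exact h.1.le

theorem irr_len {U : Word g} (hU : IrreducibleWord g U) : len g (eval g U) = U.length := by
  obtain ⟨W, h1, h2⟩ := exists_geo_word (eval g U)
  have := irr_min hU h2
  have := len_eval_le U
  omega

theorem eval_append (A B : Word g) : eval g (A ++ B) = eval g A * eval g B := by
  simp [eval]

theorem eval_fl (hg : 2 ≤ g) {F : Word g} {c d} {m : ℕ} (h : F.map (pos g) = fl c d m) :
    eval g F = pr hg c d m := by
  rw [eval_eq hg, h]; rfl

theorem irr_short (hg : 2 ≤ g) {P F Q : Word g} (hU : IrreducibleWord g (P ++ F ++ Q)) {c d} {m : ℕ}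
    (hd : d = 1 ∨ d = -1) (hm : m ≤ 4*g) (h : F.map (pos g) = fl c d m) : m ≤ 2*g := by
  obtain ⟨n, hn⟩ : ∃ n, 4*g = m + n := ⟨4*g-m, by omega⟩
  have h1 := pr_full hg c d hd
  rw [show pr hg c d (4*g) = pr hg c d (m+n) by congr 1, pr_add] at h1
  have h2 := eq_inv_of_mul_eq_one_left h1
  rw [pr_inv] at h2
  have hF : m = F.length := by rw [← length_fl c d m, ← h, List.length_map]
  have := irr_min hU (W := P ++ (fl _ _ n).map (θ hg).symm ++ Q) (by
    rw [eval_append, eval_append, eval_append, eval_append, eval_fl hg h, h2,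
      eval_fl hg (map_symm_pos hg _)])
  simp only [List.length_append, List.length_map, length_fl, ← hF] at this
  omega

theorem lex_strip {A B : Word g} (P : Word g)
    (h : List.Lex (letterLt g) (P ++ A) (P ++ B)) : List.Lex (letterLt g) A B := by
  induction P with
  | nil => exact h
  | cons p P ih =>
    cases h with
    | rel h => exact absurd h (lt_irrefl _)
    | cons h => exact ih h

theorem irr_lex (hg : 2 ≤ g) {P F Q : Word g} (hU : IrreducibleWord g (P ++ F ++ Q)) {c d}
    (hd : d = 1 ∨ d = -1) (h : F.map (pos g) = fl c d (2*g)) :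
    rank g ((θ hg).symm c) < rank g ((θ hg).symm (c + Tg g - d)) := by
  have hinj : Function.Injective (List.map (pos g)) := List.map_injective_iff.2 (pos_bij hg).1
  have hF : F = (fl c d (2*g)).map (θ hg).symm := hinj (by rw [h, map_symm_pos])
  obtain ⟨n, hn⟩ : ∃ n, 2*g = n + 1 := ⟨2*g-1, by omega⟩
  have hne : (θ hg).symm c ≠ (θ hg).symm (c + Tg g - d) := by
    intro h0
    have h0 := (θ hg).symm.injective h0
    have := Tg_pm hg
    rcases hd with rfl | rfl
    · exact this.2 (by linear_combination -h0)
    · exact this.1 (by linear_combination -h0)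
  have he : eval g (P ++ (fl (c + Tg g - d) (-d) (2*g)).map (θ hg).symm ++ Q) =
      eval g (P ++ F ++ Q) := by
    rw [eval_append, eval_append, eval_append, eval_append, eval_fl hg h,
      eval_fl hg (map_symm_pos hg _), pr_half hg c d hd]
  have hf : ∀ k d : ZMod (4*g), fl k d (2*g) = k :: fl (k + d) d n := by
    intro k d
    rw [show fl k d (2*g) = fl k d (n+1) by congr 1]; rfl
  have key := hU _ he
  rw [hF, hf, hf] at key
  simp only [List.append_assoc, List.map_cons, List.cons_append] at key
  rcases key with h1 | h1 | ⟨-, h1⟩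
  · have h2 := List.append_cancel_left h1
    exact absurd (List.cons.inj h2).1.symm hne
  · simp [length_fl] at h1
  · have h2 := lex_strip P h1
    rcases List.cons_lex_cons_iff.1 h2 with h | ⟨h, -⟩
    · exact h
    · exact absurd h hne

theorem rank_inv (a : Letter g) : rank g (invLetter g a) + rank g a + 1 = 4*g := by
  obtain ⟨i, b⟩ := a
  have := i.2
  cases b <;> simp [rank, invLetter] <;> omega

theorem symm_add (hg : 2 ≤ g) (k) : (θ hg).symm (k + Tg g) = invLetter g ((θ hg).symm k) := by
  rw [Equiv.symm_apply_eq, θ_apply, pos_inv, ← θ_apply hg, Equiv.apply_symm_apply]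

/-- no full relator straddles the junction -/
theorem no_full (hg : 2 ≤ g) {P F1 F2 Q : Word g} (hU : IrreducibleWord g (P ++ F1))
    (hV : IrreducibleWord g (F2 ++ Q)) {c d} {m n : ℕ} (hd : d = 1 ∨ d = -1) (hmn : m + n = 4*g)
    (h1 : F1.map (pos g) = fl c d m) (h2 : F2.map (pos g) = fl (c + (m : ZMod (4*g)) * d) d n) : False := by
  have hU' : IrreducibleWord g (P ++ F1 ++ []) := by simpa using hU
  have hV' : IrreducibleWord g ([] ++ F2 ++ Q) := by simpa using hV
  have hm := irr_short hg hU' hd (by omega) h1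
  have hn := irr_short hg hV' hd (by omega) h2
  obtain rfl : m = 2*g := by omega
  obtain rfl : n = 2*g := by omega
  have h3 := irr_lex hg hU' hd h1
  have h4 := irr_lex hg hV' hd h2
  have h5 : c + ((2*g : ℕ) : ZMod (4*g)) * d = c + Tg g := by
    have : ((2*g : ℕ) : ZMod (4*g)) = Tg g := rfl
    rw [this]
    rcases hd with rfl | rfl
    · ring
    · linear_combination - Tg_add g
  rw [h5, show c + Tg g + Tg g - d = (c + Tg g - d) + Tg g by ring, symm_add, symm_add] at h4
  have h6 := rank_inv ((θ hg).symm c)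
  have h7 := rank_inv ((θ hg).symm (c + Tg g - d))
  omega

theorem no_split (hg : 2 ≤ g) {U V : Word g} (hU : IrreducibleWord g U) (hV : IrreducibleWord g V)
    (hno : ¬ HasLLFR g (4*g-1) (U ++ V)) {P F1 F2 Q : Word g} (eU : U = P ++ F1) (eV : V = F2 ++ Q)
    {c d} {m n : ℕ} (hd : d = 1 ∨ d = -1) (hmn : m + n + 1 = 4*g)
    (h1 : F1.map (pos g) = fl c d m) (h2 : F2.map (pos g) = fl (c + (m : ZMod (4*g)) * d) d n) : False := by
  subst eU eV
  have hF : (F1 ++ F2).map (pos g) = fl c d (4*g-1) := by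
    rw [List.map_append, h1, h2, ← fl_add]
    congr 1; omega
  obtain ⟨r, hr⟩ : ∃ r, 4*g - 1 = r + 2 := ⟨4*g-3, by omega⟩
  have hfl : ∀ k d : ZMod (4*g), fl k d (4*g-1) = fl k d (r + 2) := by
    intro k d; congr 1
  have hfl' : ∀ k d : ZMod (4*g), fl k d (4*g-1+1) = fl k d (4*g-1) ++ [k + (4*g-1 : ℕ) * d] := by
    intro k d; rw [fl_add]; rfl
  apply hno
  refine ⟨P, F1 ++ F2, Q, by simp, ?_, ?_, ?_⟩
  · exact (isFR_iff hg _ _).2 ⟨by omega, by omega, c, d, hd, hF⟩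
  · intro a ha hFR
    obtain ⟨-, -, k', d', hd', h⟩ := (isFR_iff hg _ _).1 hFR
    rw [List.map_cons, hF] at h
    simp only [fl] at h
    obtain ⟨e1, e2⟩ := List.cons.inj h
    rw [hfl, hfl] at e2
    simp only [fl] at e2
    obtain ⟨e3, e4⟩ := List.cons.inj e2
    obtain ⟨e5, -⟩ := List.cons.inj e4
    have e6 : d' = d := by linear_combination e3 - e5
    subst e6
    obtain ⟨P', rfl⟩ : ∃ P', P = P' ++ [a] := by
      obtain ⟨l, hl⟩ := List.getLast?_eq_some_iff.1 ha
      exact ⟨l, hl⟩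
    refine no_full hg (P := P') (F1 := a :: F1) (F2 := F2) (Q := Q) (c := c - d') (d := d')
      (m := m + 1) (n := n) (by simpa using hU) hV hd (by omega) ?_ ?_
    · rw [List.map_cons, h1, e1]
      simp only [fl]
      rw [sub_add_cancel]
      congr 1
      linear_combination -e3
    · rw [h2]; congr 1; push_cast; ring
  · intro a ha hFR
    obtain ⟨-, -, k', d', hd', h⟩ := (isFR_iff hg _ _).1 hFR
    rw [List.map_append, hF, hfl'] at h
    obtain ⟨e1, e2⟩ := List.append_inj h (by simp [length_fl])
    rw [hfl, hfl] at e1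
    simp only [fl] at e1
    obtain ⟨e3, e4⟩ := List.cons.inj e1
    obtain ⟨e5, -⟩ := List.cons.inj e4
    subst e3
    have e6 : d' = d := by linear_combination -e5
    subst e6
    obtain ⟨Q', rfl⟩ : ∃ Q', Q = a :: Q' := by
      cases Q with
      | nil => simp at ha
      | cons q Q => simp at ha; exact ⟨Q, by rw [ha]⟩
    refine no_full hg (P := P) (F1 := F1) (F2 := F2 ++ [a]) (Q := Q') (c := c) (d := d')
      (m := m) (n := n + 1) hU (by simpa using hV) hd (by omega) h1 ?_
    rw [List.map_append, h2, fl_add, e2]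
    congr 1
    simp only [fl]
    rw [show 4*g - 1 = m + n by omega]
    congr 1
    push_cast; ring

theorem hyp_split (hg : 2 ≤ g) {U V : Word g} (hU : IrreducibleWord g U) (hV : IrreducibleWord g V)
    (hno : ¬ HasLLFR g (4*g-1) (U ++ V)) {k d} {m n : ℕ} (hd : d = 1 ∨ d = -1)
    (hmn : m + n + 1 = 4*g) (h1 : fl k d m <+: (wordInv g U).map (pos g))
    (h2 : fl (k + Tg g - d) (-d) n <+: V.map (pos g)) : False := by
  rw [wordInv_pos] at h1
  have h3 : fl (k + ((m : ZMod (4*g)) - 1) * d + Tg g) (-d) m <:+ U.map (pos g) := by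
    have h4 := List.reverse_suffix.2 h1
    rw [List.reverse_reverse, fl_reverse] at h4
    have h5 := h4.map (· + Tg g)
    rw [fl_map_add, List.map_map] at h5
    have : ((· + Tg g) ∘ (· + Tg g) : ZMod (4*g) → ZMod (4*g)) = id := by
      ext1 x; simp [add_assoc, Tg_add]
    rwa [this, List.map_id] at h5
  obtain ⟨A, hA⟩ := h3
  obtain ⟨B, hB⟩ := h2
  obtain ⟨P, F1, eU, -, hF1⟩ := List.map_eq_append_iff.1 hA.symm
  obtain ⟨F2, Q, eV, hF2, -⟩ := List.map_eq_append_iff.1 hB.symm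
  refine no_split hg hU hV hno eU eV (c := k + ((m : ZMod (4*g)) - 1) * d + Tg g) (d := -d) (m := m) (n := n)
    (by rcases hd with rfl | rfl <;> simp) hmn hF1 ?_
  rw [hF2]
  congr 1
  ring

theorem eval_wordInv (W : Word g) : eval g (wordInv g W) = (eval g W)⁻¹ := by
  unfold eval wordInv
  rw [List.prod_inv_reverse, List.map_reverse, List.map_map, List.map_map]
  congr 3
  ext1 a
  exact evalLetter_inv a

theorem final (hg : 2 ≤ g) (U V : Word g)
    (hU : IrreducibleWord g U) (hV : IrreducibleWord g V)
    (hfr : FreelyReduced g (U ++ V)) (hno : ¬ HasLLFR g (4*g-1) (U ++ V)) :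
    U.length + V.length ≤ len g (eval g (U ++ V)) + 4*g := by
  have lU := irr_len hU
  have lV := irr_len hV
  rcases List.eq_nil_or_concat U with rfl | ⟨U', a, rfl⟩
  · simp only [List.nil_append, List.length_nil]; omega
  rcases V with _ | ⟨b, V'⟩
  · simp only [List.append_nil, List.length_nil]; omega
  simp only [List.concat_eq_append] at *
  have hab : b ≠ invLetter g a := by
    unfold FreelyReduced at hfr
    rw [List.append_assoc] at hfr
    have h1 := (List.isChain_append.1 hfr).2.1
    simp only [List.cons_append, List.nil_append] at h1
    exact (List.isChain_cons_cons.1 h1).1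
  obtain ⟨ks, hks⟩ : ∃ ks, (wordInv g (U' ++ [a])).map (pos g) = pos g (invLetter g a) :: ks := by
    refine ⟨(wordInv g U').map (pos g), ?_⟩
    simp [wordInv]
  have hij : pos g (invLetter g a) ≠ pos g b := fun h => hab ((pos_bij hg).1 h).symm
  have hx : (surf hg).Geo (pos g (invLetter g a) :: ks) (eval g (U' ++ [a]))⁻¹ := by
    constructor
    · rw [← hks, ← eval_wordInv]
      exact (eval_eq hg _).symm
    · rw [← hks, (surf hg).ln_inv]
      refine Eq.trans lU ?_
      simp [wordInv]
  have hy : (surf hg).Geo (pos g b :: V'.map (pos g)) (eval g (b :: V')) := by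
    constructor
    · rw [← List.map_cons]
      exact (eval_eq hg _).symm
    · refine Eq.trans lV ?_
      simp
  have H : (surf hg).Hyp (pos g (invLetter g a) :: ks) (pos g b :: V'.map (pos g)) := by
    intro k d hd
    rw [← hks, ← List.map_cons]
    constructor
    · rintro ⟨h1, h2⟩
      exact hyp_split hg hU hV hno hd (by omega) h1 h2
    · rintro ⟨h1, h2⟩
      exact hyp_split hg hU hV hno hd (by omega) h1 h2
  have key := (surf hg).main_abstract hij hx hy H
  rw [(surf hg).ln_inv, inv_inv, ← eval_append] at key
  have key' : len g (eval g (U' ++ [a])) + len g (eval g (b :: V')) ≤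
    len g (eval g (U' ++ [a] ++ b :: V')) + 4*g := key
  omega

end Final

end SG

/-- If `U, V` are irreducible, `UV` is freely reduced and contains no
`(4g−1)`-LLFR, then `|U| + |V| − |w| ≤ 4g` where `w` is the element of `UV`. -/
theorem no_long_LLFR_length_loss (g : ℕ) (hg : 2 ≤ g) (U V : SG.Word g)
    (hU : SG.IrreducibleWord g U) (hV : SG.IrreducibleWord g V)
    (hfr : SG.FreelyReduced g (U ++ V))
    (hno : ¬ SG.HasLLFR g (4*g-1) (U ++ V)) :
    U.length + V.length - SG.len g (SG.eval g (U ++ V)) ≤ 4*g := by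
  have := SG.final hg U V hU hV hfr hno
  omega
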